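/- Let (X,d,m) be a PI space and let E, F ⊆ X be sets of locally finite perimeter with P(E, ∂^e F) = 0. Then for every Borel set B ⊆ X it holds that P(E ∩ F, B) ≤ P(E, B ∩ F^(1)) + P(F, B ∩ E^(1)). -/

import Mathlib

open MeasureTheory Metric Set Filter Topology ENNReal Bornology
open scoped symmDiff

noncomputable section

variable {X : Type*}

/-- The slope (pointwise Lipschitz constant) of `f` at `x`, computed within `Ω`.
It vanishes at points that are isolated in `Ω`. -/
def slopeOn [MetricSpace X] (Ω : Set X) (f : X → ℝ) (x : X) : ℝ≥0∞ :=
  Filter.limsup (fun y => ENNReal.ofReal (|f x - f y| / dist x y)) (𝓝[Ω \ {x}] x)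

/-- The slope of `f`. -/
def mSlope [MetricSpace X] (f : X → ℝ) (x : X) : ℝ≥0∞ := slopeOn Set.univ f x

/-- `f` is locally Lipschitz on `Ω`. -/
def LocLipOn [MetricSpace X] (Ω : Set X) (f : X → ℝ) : Prop :=
  ∀ x ∈ Ω, ∃ r > (0:ℝ), ∃ K : NNReal, LipschitzOnWith K f (Metric.ball x r ∩ Ω)

/-- Convergence `fn → f` in `L¹_loc(Ω)` w.r.t. the measure `m`. -/
def TendstoL1loc [MetricSpace X] [MeasurableSpace X] (m : Measure X) (Ω : Set X)
    (fn : ℕ → X → ℝ) (f : X → ℝ) : Prop :=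
  ∀ K : Set X, K ⊆ Ω → IsCompact K →
    Tendsto (fun n => ∫⁻ x in K, ENNReal.ofReal |fn n x - f x| ∂m) atTop (𝓝 0)

/-- The total variation `|Df|(B)` of `f : X → ℝ` on the set `B`. -/
def totVar [MetricSpace X] [MeasurableSpace X] (m : Measure X) (f : X → ℝ) (B : Set X) : ℝ≥0∞ :=
  ⨅ (Ω : Set X) (_ : IsOpen Ω) (_ : B ⊆ Ω),
    ⨅ (fn : ℕ → X → ℝ) (_ : ∀ n, LocLipOn Ω (fn n)) (_ : TendstoL1loc m Ω fn f),
      Filter.liminf (fun n => ∫⁻ x in Ω, slopeOn Ω (fn n) x ∂m) atTop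

/-- The perimeter `P(E, B)` of a set `E` in `B`. -/
def Per [MetricSpace X] [MeasurableSpace X] (m : Measure X) (E B : Set X) : ℝ≥0∞ :=
  totVar m (Set.indicator E fun _ => (1:ℝ)) B

/-- `E` has locally finite perimeter. -/
def HasLocFinPer [MetricSpace X] [MeasurableSpace X] (m : Measure X) (E : Set X) : Prop :=
  ∀ x : X, ∃ r > (0:ℝ), Per m E (Metric.ball x r) < ∞

/-- `E` has finite perimeter. -/
def HasFinPer [MetricSpace X] [MeasurableSpace X] (m : Measure X) (E : Set X) : Prop :=
  Per m E Set.univ < ∞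

/-- `m` is finite on bounded sets. -/
def BoundedlyFinite [MetricSpace X] [MeasurableSpace X] (m : Measure X) : Prop :=
  ∀ B : Set X, Bornology.IsBounded B → m B < ∞

/-- Uniformly locally doubling with doubling function `C_D`. -/
def UnifLocDoublingWith [MetricSpace X] [MeasurableSpace X] (C_D : ℝ → ℝ) (m : Measure X) : Prop :=
  ∀ R : ℝ, 0 < R → ∀ x : X, ∀ r : ℝ, 0 < r → r < R →
    m (Metric.ball x (2 * r)) ≤ ENNReal.ofReal (C_D R) * m (Metric.ball x r)

/-- Weak local (1,1)-Poincaré inequality with dilation `lam` and constant function `C_P`. -/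
def WeakPoincareWith [MetricSpace X] [MeasurableSpace X] (lam : ℝ) (C_P : ℝ → ℝ)
    (m : Measure X) : Prop :=
  ∀ f : X → ℝ, LocLipOn Set.univ f → ∀ R : ℝ, 0 < R → ∀ x : X, ∀ r : ℝ, 0 < r → r < R →
    (∫⁻ y in Metric.ball x r,
        ENNReal.ofReal |f y - ⨍ z in Metric.ball x r, f z ∂m| ∂m) / m (Metric.ball x r)
      ≤ ENNReal.ofReal (C_P R * r) *
          ((∫⁻ y in Metric.ball x (lam * r), mSlope f y ∂m) / m (Metric.ball x (lam * r)))

/-- `(X, d, m)` is a PI space. -/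
def IsPIspace [MetricSpace X] [MeasurableSpace X] (m : Measure X) : Prop :=
  (∃ C_D : ℝ → ℝ, (∀ R, 0 < R → 0 < C_D R) ∧ UnifLocDoublingWith C_D m) ∧
  (∃ lam : ℝ, 1 ≤ lam ∧ ∃ C_P : ℝ → ℝ, (∀ R, 0 < R → 0 < C_P R) ∧ WeakPoincareWith lam C_P m)

/-- `(X, d)` is a length space: the distance between two points is the infimum of the
lengths of continuous curves joining them. -/
def IsLengthSpace (X : Type*) [MetricSpace X] : Prop :=
  ∀ p q : X, ENNReal.ofReal (dist p q) =
    ⨅ (γ : ℝ → X) (_ : ContinuousOn γ (Set.Icc 0 1)) (_ : γ 0 = p) (_ : γ 1 = q),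
      eVariationOn γ (Set.Icc 0 1)

/-- Essential interior `E^{(1)}`. -/
def essInt [MetricSpace X] [MeasurableSpace X] (m : Measure X) (E : Set X) : Set X :=
  { x | Tendsto (fun r : ℝ => m (E ∩ Metric.ball x r) / m (Metric.ball x r)) (𝓝[>] 0) (𝓝 1) }

/-- Essential exterior `E^{(0)}`. -/
def essExt [MetricSpace X] [MeasurableSpace X] (m : Measure X) (E : Set X) : Set X :=
  { x | Tendsto (fun r : ℝ => m (E ∩ Metric.ball x r) / m (Metric.ball x r)) (𝓝[>] 0) (𝓝 0) }

/-- Essential boundary `∂^e E`. -/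
def essBdry [MetricSpace X] [MeasurableSpace X] (m : Measure X) (E : Set X) : Set X :=
  (essInt m E ∪ essExt m E)ᶜ

/-- The two deformation inequalities hold for `E` at `x` with radius `R` and constant `C`. -/
def DeformIneq [MetricSpace X] [MeasurableSpace X] (m : Measure X) (E : Set X) (x : X)
    (R C : ℝ) : Prop :=
  ∀ y ∈ Metric.ball x R, ∀ r ∈ Set.Ioo (0:ℝ) R,
    Per m (E \ Metric.ball y r) (Metric.ball x (2 * R)) ≤
      ENNReal.ofReal C * m (Metric.ball y r ∩ E) / ENNReal.ofReal r +
        Per m E (Metric.ball x (2 * R)) ∧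
    Per m (E ∪ Metric.ball y r) (Metric.ball x (2 * R)) ≤
      ENNReal.ofReal C * m (Metric.ball y r \ E) / ENNReal.ofReal r +
        Per m E (Metric.ball x (2 * R))

/-- The deformation inequalities hold for `E` at `x` with radius `R` and some constant. -/
def DeformAt [MetricSpace X] [MeasurableSpace X] (m : Measure X) (E : Set X) (x : X)
    (R : ℝ) : Prop :=
  0 < R ∧ R ≤ 1 ∧ ∃ C : ℝ, 0 ≤ C ∧ DeformIneq m E x R C

/-- `R_x(E)`: the maximal radius in `(0,1]` for which the deformation inequalities hold. -/
def deformRadius [MetricSpace X] [MeasurableSpace X] (m : Measure X) (E : Set X) (x : X) : ℝ :=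
  sSup { R : ℝ | DeformAt m E x R }

/-- `(X, d, m)` has the deformation property. -/
def DeformationProperty [MetricSpace X] [MeasurableSpace X] (m : Measure X) : Prop :=
  ∀ E : Set X, MeasurableSet E → HasLocFinPer m E → ∀ x : X, ∃ R : ℝ, DeformAt m E x R

/-- `E` is a volume-constrained minimizer of the perimeter. -/
def VolConstMin [MetricSpace X] [MeasurableSpace X] (m : Measure X) (E : Set X) : Prop :=
  MeasurableSet E ∧ HasLocFinPer m E ∧
    ∀ F K : Set X, MeasurableSet F → IsCompact K →
      m ((E ∆ F) \ K) = 0 → m (E ∩ K) = m (F ∩ K) → Per m E K ≤ Per m F K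

/-- `E` is an isoperimetric set. -/
def IsIsoperimetricSet [MetricSpace X] [MeasurableSpace X] (m : Measure X) (E : Set X) : Prop :=
  MeasurableSet E ∧ HasFinPer m E ∧ 0 < m E ∧ m E < ∞ ∧
    ∀ F : Set X, MeasurableSet F → m F = m E → Per m E Set.univ ≤ Per m F Set.univ

theorem ENNReal.limsup_add_le_add {ι : Type*} (l : Filter ι) (u v : ι → ℝ≥0∞) :
    limsup (fun i => u i + v i) l ≤ limsup u l + limsup v l := by
  refine ENNReal.le_of_forall_pos_le_add fun ε hε hlt => ?_
  have hu : limsup u l ≠ ∞ := (lt_of_le_of_lt le_self_add hlt).ne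
  have hv : limsup v l ≠ ∞ := (lt_of_le_of_lt le_add_self hlt).ne
  have hε2 : (ε : ℝ≥0∞) / 2 ≠ 0 := by simp [hε.ne']
  have h1 := eventually_lt_of_limsup_lt (ENNReal.lt_add_right hu hε2)
  have h2 := eventually_lt_of_limsup_lt (ENNReal.lt_add_right hv hε2)
  refine limsup_le_of_le (by isBoundedDefault) ?_
  filter_upwards [h1, h2] with i hi1 hi2
  calc u i + v i ≤ (limsup u l + ε / 2) + (limsup v l + ε / 2) := add_le_add hi1.le hi2.le
    _ = limsup u l + limsup v l + (ε / 2 + ε / 2) := by ring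
    _ = _ := by rw [ENNReal.add_halves]

section Slope

variable [MetricSpace X]

theorem slopeOn_eq_mSlope {Ω : Set X} (hΩ : IsOpen Ω) {x : X} (hx : x ∈ Ω) (f : X → ℝ) :
    slopeOn Ω f x = mSlope f x := by
  have : 𝓝[Ω \ {x}] x = 𝓝[univ \ {x}] x := by
    rw [sdiff_eq, sdiff_eq, univ_inter, inter_comm,
      nhdsWithin_inter_of_mem' (mem_nhdsWithin_of_mem_nhds (hΩ.mem_nhds hx))]
  simp only [mSlope, slopeOn, this]

theorem mSlope_mono {f g : X → ℝ} {x : X}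
    (h : ∀ᶠ y in 𝓝 x, |f x - f y| ≤ |g x - g y|) : mSlope f x ≤ mSlope g x := by
  refine limsup_le_limsup ?_ (by isBoundedDefault) (by isBoundedDefault)
  filter_upwards [nhdsWithin_le_nhds h] with y hy
  gcongr

theorem mSlope_congr {f g : X → ℝ} {x : X} (h : f =ᶠ[𝓝 x] g) : mSlope f x = mSlope g x := by
  have hx := h.self_of_nhds
  apply le_antisymm <;> refine mSlope_mono ?_ <;> filter_upwards [h] with y hy <;> rw [hx, hy]

theorem mSlope_sub_const (f : X → ℝ) (c : ℝ) (x : X) : mSlope (fun y => f y - c) x = mSlope f x := by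
  apply le_antisymm <;> refine mSlope_mono ?_ <;> simp

theorem mSlope_le_ofReal {f : X → ℝ} {x : X} {K : ℝ}
    (h : ∀ᶠ y in 𝓝 x, |f x - f y| ≤ K * dist x y) : mSlope f x ≤ ENNReal.ofReal K := by
  refine limsup_le_of_le (by isBoundedDefault) ?_
  filter_upwards [nhdsWithin_le_nhds h, self_mem_nhdsWithin] with y hy hne
  have : 0 < dist x y := dist_pos.2 (Ne.symm hne.2)
  exact ENNReal.ofReal_le_ofReal ((div_le_iff₀ this).2 hy)

theorem mSlope_const (c : ℝ) (x : X) : mSlope (fun _ => c) x = 0 := by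
  have := mSlope_le_ofReal (f := fun _ : X => c) (x := x) (K := 0) (by simp)
  simpa using this

theorem mSlope_eq_zero_of_eventuallyEq_const {f : X → ℝ} {x : X} {c : ℝ}
    (h : f =ᶠ[𝓝 x] fun _ => c) : mSlope f x = 0 := by
  rw [mSlope_congr h, mSlope_const]

theorem mSlope_add_le (f g : X → ℝ) (x : X) :
    mSlope (fun y => f y + g y) x ≤ mSlope f x + mSlope g x := by
  refine le_trans ?_ (ENNReal.limsup_add_le_add _ _ _)
  refine limsup_le_limsup ?_ (by isBoundedDefault) (by isBoundedDefault)
  refine Eventually.of_forall fun y => ?_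
  simp only
  rw [← ENNReal.ofReal_add (by positivity) (by positivity), ← add_div]
  gcongr
  have : f x + g x - (f y + g y) = (f x - f y) + (g x - g y) := by ring
  rw [this]
  exact abs_add_le _ _

theorem mSlope_sum_le {ι : Type*} (s : Finset ι) (f : ι → X → ℝ) (x : X) :
    mSlope (fun y => ∑ i ∈ s, f i y) x ≤ ∑ i ∈ s, mSlope (f i) x := by
  classical
  induction s using Finset.induction_on with
  | empty => simp [mSlope_const]
  | insert a s ha ih =>
    simp only [Finset.sum_insert ha]
    exact (mSlope_add_le _ _ x).trans (by gcongr)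

theorem mSlope_mul_le {φ f : X → ℝ} {x : X} (hφ : ContinuousAt φ x) (hf : mSlope f x ≠ ∞) :
    mSlope (fun y => φ y * f y) x ≤
      ENNReal.ofReal |φ x| * mSlope f x + ENNReal.ofReal |f x| * mSlope φ x := by
  have hlim : limsup (fun y => ENNReal.ofReal |φ y|) (𝓝[univ \ {x}] x) ≤ ENNReal.ofReal |φ x| := by
    have ht : Tendsto (fun y => ENNReal.ofReal |φ y|) (𝓝[univ \ {x}] x) (𝓝 (ENNReal.ofReal |φ x|)) :=
      (ENNReal.continuous_ofReal.tendsto _).comp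
        ((continuous_abs.tendsto _).comp (hφ.mono_left nhdsWithin_le_nhds))
    rcases eq_or_neBot (𝓝[univ \ {x}] x) with h | h
    · rw [h]; simp
    · exact ht.limsup_eq.le
  have h1 : limsup (fun y => ENNReal.ofReal |φ y| * ENNReal.ofReal (|f x - f y| / dist x y))
      (𝓝[univ \ {x}] x) ≤ ENNReal.ofReal |φ x| * mSlope f x := by
    refine (ENNReal.limsup_mul_le' (Or.inr hf) (Or.inl (ne_top_of_le_ne_top ofReal_ne_top hlim))).trans ?_
    gcongr
    exact le_rfl
  have h2 : limsup (fun y => ENNReal.ofReal |f x| * ENNReal.ofReal (|φ x - φ y| / dist x y))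
      (𝓝[univ \ {x}] x) = ENNReal.ofReal |f x| * mSlope φ x :=
    ENNReal.limsup_const_mul_of_ne_top ofReal_ne_top
  refine le_trans ?_ (add_le_add h1 h2.le)
  refine le_trans ?_ (ENNReal.limsup_add_le_add _ _ _)
  refine limsup_le_limsup ?_ (by isBoundedDefault) (by isBoundedDefault)
  refine Eventually.of_forall fun y => ?_
  simp only
  rw [← ENNReal.ofReal_mul (by positivity), ← ENNReal.ofReal_mul (by positivity),
    ← ENNReal.ofReal_add (by positivity) (by positivity), ← mul_div_assoc, ← mul_div_assoc, ← add_div]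
  gcongr
  have : φ x * f x - φ y * f y = φ y * (f x - f y) + f x * (φ x - φ y) := by ring
  rw [this, ← abs_mul, ← abs_mul]
  exact abs_add_le _ _

/-- `f` is Lipschitz on a neighbourhood of `x`. -/
def LipNear (f : X → ℝ) (x : X) : Prop := ∃ K : NNReal, ∃ s ∈ 𝓝 x, LipschitzOnWith K f s

theorem locLipOn_iff {Ω : Set X} (hΩ : IsOpen Ω) {f : X → ℝ} :
    LocLipOn Ω f ↔ ∀ x ∈ Ω, LipNear f x := by
  constructor
  · intro h x hx
    obtain ⟨r, hr, K, hK⟩ := h x hx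
    exact ⟨K, _, inter_mem (ball_mem_nhds x hr) (hΩ.mem_nhds hx), hK⟩
  · intro h x hx
    obtain ⟨K, s, hs, hK⟩ := h x hx
    obtain ⟨r, hr, hrs⟩ := Metric.mem_nhds_iff.1 hs
    exact ⟨r, hr, K, hK.mono (inter_subset_left.trans hrs)⟩

theorem LipNear.continuousAt {f : X → ℝ} {x : X} (h : LipNear f x) : ContinuousAt f x := by
  obtain ⟨K, s, hs, hK⟩ := h
  exact hK.continuousOn.continuousAt hs

theorem LipNear.mSlope_ne_top {f : X → ℝ} {x : X} (h : LipNear f x) : mSlope f x ≠ ∞ := by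
  obtain ⟨K, s, hs, hK⟩ := h
  refine ne_top_of_le_ne_top ofReal_ne_top (mSlope_le_ofReal (K := K) ?_)
  filter_upwards [hs] with y hy
  simpa [Real.dist_eq] using hK.dist_le_mul x (mem_of_mem_nhds hs) y hy

theorem LipschitzWith.lipNear {f : X → ℝ} {K : NNReal} (h : LipschitzWith K f) (x : X) :
    LipNear f x := ⟨K, univ, univ_mem, h.lipschitzOnWith⟩

theorem LipschitzWith.mSlope_le {f : X → ℝ} {K : NNReal} (h : LipschitzWith K f) (x : X) :
    mSlope f x ≤ K := by
  have := mSlope_le_ofReal (f := f) (x := x) (K := K)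
    (Eventually.of_forall fun y => by simpa [Real.dist_eq] using h.dist_le_mul x y)
  simpa using this

theorem LipNear.congr {f g : X → ℝ} {x : X} (h : LipNear f x) (hfg : f =ᶠ[𝓝 x] g) :
    LipNear g x := by
  obtain ⟨K, s, hs, hK⟩ := h
  refine ⟨K, s ∩ {y | f y = g y}, inter_mem hs hfg, fun y hy z hz => ?_⟩
  rw [← hy.2, ← hz.2]
  exact hK hy.1 hz.1

theorem lipNear_const (c : ℝ) (x : X) : LipNear (fun _ => c) x :=
  (LipschitzWith.const c).lipNear x

/-- A Lipschitz-type estimate transfers Lipschitz regularity near a point. -/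
theorem LipNear.of_abs_le {f g : X → ℝ} {x : X} (h : LipNear g x)
    (hfg : ∀ y z, |f y - f z| ≤ |g y - g z|) : LipNear f x := by
  obtain ⟨K, s, hs, hK⟩ := h
  refine ⟨K, s, hs, LipschitzOnWith.of_dist_le_mul fun y hy z hz => ?_⟩
  rw [Real.dist_eq]
  exact (hfg y z).trans (by simpa [Real.dist_eq] using hK.dist_le_mul y hy z hz)

theorem LipNear.add {f g : X → ℝ} {x : X} (hf : LipNear f x) (hg : LipNear g x) :
    LipNear (fun y => f y + g y) x := by
  obtain ⟨K, s, hs, hK⟩ := hf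
  obtain ⟨K', s', hs', hK'⟩ := hg
  exact ⟨K + K', s ∩ s', inter_mem hs hs',
    (hK.mono inter_subset_left).add (hK'.mono inter_subset_right)⟩

theorem LipNear.sum {ι : Type*} (s : Finset ι) {f : ι → X → ℝ} {x : X}
    (hf : ∀ i ∈ s, LipNear (f i) x) : LipNear (fun y => ∑ i ∈ s, f i y) x := by
  classical
  induction s using Finset.induction_on with
  | empty => simpa using lipNear_const 0 x
  | insert a s ha ih =>
    simp only [Finset.sum_insert ha]
    exact (hf a (by simp)).add (ih fun i hi => hf i (by simp [hi]))

theorem LipNear.mul {f g : X → ℝ} {x : X} (hf : LipNear f x) (hg : LipNear g x) :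
    LipNear (fun y => f y * g y) x := by
  have hfb : ∀ᶠ y in 𝓝 x, |f y| ≤ |f x| + 1 :=
    (hf.continuousAt.abs.eventually (gt_mem_nhds (lt_add_one _))).mono fun _ h => h.le
  have hgb : ∀ᶠ y in 𝓝 x, |g y| ≤ |g x| + 1 :=
    (hg.continuousAt.abs.eventually (gt_mem_nhds (lt_add_one _))).mono fun _ h => h.le
  obtain ⟨K, s, hs, hK⟩ := hf
  obtain ⟨K', s', hs', hK'⟩ := hg
  refine ⟨(|f x| + 1).toNNReal * K' + (|g x| + 1).toNNReal * K,
    (s ∩ s') ∩ ({y | |f y| ≤ |f x| + 1} ∩ {y | |g y| ≤ |g x| + 1}),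
    inter_mem (inter_mem hs hs') (inter_mem hfb hgb), LipschitzOnWith.of_dist_le_mul ?_⟩
  rintro y ⟨⟨hy1, hy2⟩, hy3, hy4⟩ z ⟨⟨hz1, hz2⟩, hz3, hz4⟩
  have e1 := hK.dist_le_mul y hy1 z hz1
  have e2 := hK'.dist_le_mul y hy2 z hz2
  rw [Real.dist_eq] at e1 e2 ⊢
  have : f y * g y - f z * g z = f y * (g y - g z) + g z * (f y - f z) := by ring
  rw [this]
  push_cast
  rw [Real.coe_toNNReal _ (by positivity), Real.coe_toNNReal _ (by positivity)]
  calc |f y * (g y - g z) + g z * (f y - f z)|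
      ≤ |f y| * |g y - g z| + |g z| * |f y - f z| := by
        rw [← abs_mul, ← abs_mul]; exact abs_add_le _ _
    _ ≤ (|f x| + 1) * (K' * dist y z) + (|g x| + 1) * (K * dist y z) := by
        gcongr
        · exact hy3
        · exact hz4
    _ = _ := by ring

theorem LipNear.inv {f : X → ℝ} {x : X} (hf : LipNear f x) (hx : 0 < f x) :
    LipNear (fun y => (f y)⁻¹) x := by
  have hb : ∀ᶠ y in 𝓝 x, f x / 2 ≤ f y :=
    (hf.continuousAt.eventually (lt_mem_nhds (half_lt_self hx))).mono fun _ h => le_of_lt h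
  obtain ⟨K, s, hs, hK⟩ := hf
  refine ⟨K / ((f x / 2) * (f x / 2)).toNNReal, s ∩ {y | f x / 2 ≤ f y}, inter_mem hs hb,
    LipschitzOnWith.of_dist_le_mul ?_⟩
  rintro y ⟨hy1, hy2⟩ z ⟨hz1, hz2⟩
  simp only [mem_ofPred_eq] at hy2 hz2
  have e1 := hK.dist_le_mul y hy1 z hz1
  rw [Real.dist_eq] at e1 ⊢
  have hy0 : 0 < f y := by linarith
  have hz0 : 0 < f z := by linarith
  rw [inv_sub_inv hy0.ne' hz0.ne', abs_div, abs_of_pos (mul_pos hy0 hz0), abs_sub_comm]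
  push_cast
  rw [Real.coe_toNNReal _ (by positivity), div_mul_eq_mul_div]
  gcongr

theorem measurable_mSlope_indicator [MeasurableSpace X] [BorelSpace X] {Ω : Set X} (hΩ : IsOpen Ω)
    {f : X → ℝ} (hf : ContinuousOn f Ω) : Measurable (Ω.indicator (mSlope f)) := by
  let q : X → X → ℝ≥0∞ := fun x y => ENNReal.ofReal (|f x - f y| / dist x y)
  let g : ℕ → X → ℝ≥0∞ := fun n x =>
    ⨆ y, ⨆ (_ : y ∈ Ω ∧ y ≠ x ∧ dist x y < 1 / (n + 1 : ℝ)), q x y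
  have hg : ∀ n, Measurable (Ω.indicator (g n)) := by
    intro n
    refine measurable_of_Ioi fun t => IsOpen.measurableSet ?_
    rw [isOpen_iff_mem_nhds]
    intro x hx
    have hxΩ : x ∈ Ω := by
      by_contra h
      simp [h] at hx
    simp only [mem_preimage, indicator_of_mem hxΩ, mem_Ioi, g, lt_iSup_iff] at hx
    obtain ⟨y, ⟨hyΩ, hyx, hd⟩, hlt⟩ := hx
    have hcd : ContinuousAt (fun z => dist z y) x := (continuous_id.dist continuous_const).continuousAt
    have hq : ContinuousAt (fun z => q z y) x :=
      ENNReal.continuous_ofReal.continuousAt.comp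
        ((((hf.continuousAt (hΩ.mem_nhds hxΩ)).sub continuousAt_const).abs).div hcd
          (dist_ne_zero.2 hyx.symm))
    filter_upwards [hΩ.mem_nhds hxΩ, hcd.eventually (gt_mem_nhds hd),
      hq.eventually (lt_mem_nhds hlt), isOpen_compl_singleton.mem_nhds hyx.symm] with z h1 h2 h3 h4
    simp only [mem_preimage, indicator_of_mem h1, mem_Ioi, g, lt_iSup_iff]
    exact ⟨y, ⟨hyΩ, fun h => h4 h.symm, h2⟩, h3⟩
  have : Ω.indicator (mSlope f) = fun x => ⨅ n, Ω.indicator (g n) x := by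
    ext x
    by_cases hx : x ∈ Ω
    · simp only [indicator_of_mem hx]
      rw [← slopeOn_eq_mSlope hΩ hx]
      have hb : (𝓝[Ω \ {x}] x).HasBasis (fun _ : ℕ => True)
          (fun n => ball x (1 / (n + 1 : ℝ)) ∩ (Ω \ {x})) :=
        nhdsWithin_hasBasis nhds_basis_ball_inv_nat_succ _
      rw [slopeOn, hb.limsup_eq_iInf_iSup]
      simp only [iInf_true]
      refine iInf_congr fun n => iSup_congr fun y => iSup_congr_Prop ?_ fun _ => rfl
      simp only [mem_inter_iff, mem_ball, Set.mem_sdiff, mem_singleton_iff, dist_comm x y]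
      tauto
    · simp [indicator_of_notMem hx]
  rw [this]
  exact Measurable.iInf hg

theorem aemeasurable_mSlope [MeasurableSpace X] [BorelSpace X] {m : Measure X} {Ω : Set X}
    (hΩ : IsOpen Ω) {f : X → ℝ} (hf : ∀ x ∈ Ω, LipNear f x) :
    AEMeasurable (mSlope f) (m.restrict Ω) := by
  have h := measurable_mSlope_indicator hΩ fun x hx => (hf x hx).continuousAt.continuousWithinAt
  refine ⟨_, h, ?_⟩
  filter_upwards [ae_restrict_mem hΩ.measurableSet] with x hx
  rw [indicator_of_mem hx]

theorem aemeasurable_of_lipNear [MeasurableSpace X] [BorelSpace X] {m : Measure X} {Ω : Set X}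
    (hΩ : IsOpen Ω) {f : X → ℝ} (hf : ∀ x ∈ Ω, LipNear f x) :
    AEMeasurable f (m.restrict Ω) :=
  ContinuousOn.aemeasurable (fun x hx => (hf x hx).continuousAt.continuousWithinAt)
    hΩ.measurableSet

end Slope

theorem ENNReal.add_liminf_le (u v : ℕ → ℝ≥0∞) :
    liminf u atTop + liminf v atTop ≤ liminf (fun n => u n + v n) atTop := by
  simp only [liminf_eq_iSup_iInf_of_nat]
  rw [ENNReal.iSup_add_iSup_of_monotone]
  · exact iSup_mono fun n => le_iInf₂ fun i hi => add_le_add (iInf₂_le i hi) (iInf₂_le i hi)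
  all_goals exact fun a b hab => le_iInf₂ fun i hi => iInf₂_le i (hab.trans hi)

theorem sum_setLIntegral_le [MeasurableSpace X] {m : Measure X} {ι : Type*} (S : Finset ι) (V : ι → Set X) {Ω : Set X}
    (hV : ∀ i ∈ S, MeasurableSet (V i)) (hΩ : MeasurableSet Ω) (hVΩ : ∀ i ∈ S, V i ⊆ Ω) {N : ℕ}
    (hN : ∀ x, ((S : Set ι) ∩ {i | x ∈ V i}).encard ≤ N) (g : X → ℝ≥0∞) :
    ∑ i ∈ S, ∫⁻ x in V i, g x ∂m ≤ N * ∫⁻ x in Ω, g x ∂m := by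
  classical
  have hsup : ∀ T : Finset ι, ∑ i ∈ T, ∫⁻ x, (V i).indicator g x ∂m ≤
      ∫⁻ x, ∑ i ∈ T, (V i).indicator g x ∂m := by
    intro T
    induction T using Finset.induction_on with
    | empty => simp
    | insert a s ha ih =>
      simp only [Finset.sum_insert ha]
      exact (add_le_add le_rfl ih).trans (le_lintegral_add _ _)
  calc ∑ i ∈ S, ∫⁻ x in V i, g x ∂m = ∑ i ∈ S, ∫⁻ x, (V i).indicator g x ∂m :=
        Finset.sum_congr rfl fun i hi => (lintegral_indicator (hV i hi) _).symm
    _ ≤ ∫⁻ x, ∑ i ∈ S, (V i).indicator g x ∂m := hsup S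
    _ ≤ ∫⁻ x, N * Ω.indicator g x ∂m := by
        refine lintegral_mono fun x => ?_
        simp only [indicator_apply, ← Finset.sum_filter, Finset.sum_const, nsmul_eq_mul]
        have h1 : ((S.filter fun i => x ∈ V i).card : ℝ≥0∞) ≤ N := by
          have h2 := hN x
          have h3 : (S : Set ι) ∩ {i | x ∈ V i} = ((S.filter fun i => x ∈ V i : Finset ι) : Set ι) := by
            ext; simp
          rw [h3, Set.encard_coe_eq_coe_finsetCard] at h2
          exact_mod_cast h2
        by_cases hx : x ∈ Ω
        · simp only [hx, if_true]; gcongr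
        · have : (S.filter fun i => x ∈ V i) = ∅ :=
            Finset.filter_eq_empty_iff.2 fun i hi hxi => hx (hVΩ i hi hxi)
          simp [this]
    _ = N * ∫⁻ x in Ω, g x ∂m := by
        rw [lintegral_const_mul' _ _ (by simp), lintegral_indicator hΩ]

section Approx

variable [MetricSpace X] [MeasurableSpace X] {m : Measure X}

theorem TendstoL1loc.mono {Ω Ω' : Set X} {fn : ℕ → X → ℝ} {f : X → ℝ}
    (h : TendstoL1loc m Ω fn f) (hΩ : Ω' ⊆ Ω) : TendstoL1loc m Ω' fn f :=
  fun K hK hKc => h K (hK.trans hΩ) hKc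

theorem Per_mono (E : Set X) {A B : Set X} (h : A ⊆ B) : Per m E A ≤ Per m E B :=
  iInf_mono fun _ => iInf_mono fun _ => le_iInf fun hB => iInf_le _ (h.trans hB)

theorem exists_isOpen_Per_lt {E A : Set X} {c : ℝ≥0∞} (h : Per m E A < c) :
    ∃ U, IsOpen U ∧ A ⊆ U ∧ Per m E U < c := by
  simp only [Per, totVar, iInf_lt_iff] at h
  obtain ⟨Ω, hΩ, hA, fn, h1, h2, h3⟩ := h
  refine ⟨Ω, hΩ, hA, ?_⟩
  simp only [Per, totVar, iInf_lt_iff]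
  exact ⟨Ω, hΩ, Subset.rfl, fn, h1, h2, h3⟩

theorem Per_le_liminf [BorelSpace X] {E A Ω : Set X} (hΩ : IsOpen Ω) (hA : A ⊆ Ω)
    {f : ℕ → X → ℝ} (hf : ∀ n, ∀ x ∈ Ω, LipNear (f n) x)
    (hlim : TendstoL1loc m Ω f (E.indicator fun _ => 1)) :
    Per m E A ≤ liminf (fun n => ∫⁻ x in Ω, mSlope (f n) x ∂m) atTop := by
  have : ∀ n, ∫⁻ x in Ω, mSlope (f n) x ∂m = ∫⁻ x in Ω, slopeOn Ω (f n) x ∂m := fun n =>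
    setLIntegral_congr_fun hΩ.measurableSet fun x hx => (slopeOn_eq_mSlope hΩ hx _).symm
  simp only [this]
  exact iInf_le_of_le Ω (iInf_le_of_le hΩ (iInf_le_of_le hA (iInf_le_of_le f
    (iInf_le_of_le (fun n => (locLipOn_iff hΩ).2 (hf n)) (iInf_le_of_le hlim le_rfl)))))

theorem Per_le_of_forall_le [BorelSpace X] {E A Ω : Set X} (hΩ : IsOpen Ω) (hA : A ⊆ Ω)
    {f : ℕ → X → ℝ} (hf : ∀ n, ∀ x ∈ Ω, LipNear (f n) x)
    (hlim : TendstoL1loc m Ω f (E.indicator fun _ => 1)) {a : ℝ≥0∞} {e : ℕ → ℝ≥0∞}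
    (he : Tendsto e atTop (𝓝 0)) (h : ∀ n, ∫⁻ x in Ω, mSlope (f n) x ∂m ≤ a + e n) :
    Per m E A ≤ a := by
  refine (Per_le_liminf hΩ hA hf hlim).trans ?_
  have ht : Tendsto (fun n => a + e n) atTop (𝓝 (a + 0)) := tendsto_const_nhds.add he
  rw [add_zero] at ht
  rw [← ht.liminf_eq]
  exact liminf_le_liminf (Eventually.of_forall h)

theorem Per_empty [BorelSpace X] (E : Set X) : Per m E ∅ = 0 := by
  refine le_antisymm ?_ bot_le
  refine Per_le_of_forall_le (f := fun _ _ => 0) (e := fun _ => 0) isOpen_empty Subset.rfl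
    (by simp) ?_ tendsto_const_nhds (by simp)
  intro K hK _
  simp [subset_empty_iff.1 hK]

/-- Optimal approximating sequences may be taken with values in `[0, 1]`. -/
theorem exists_approx [BorelSpace X] {E Ω : Set X} {c : ℝ≥0∞} (h : Per m E Ω < c) :
    ∃ f : ℕ → X → ℝ, (∀ n, ∀ x ∈ Ω, LipNear (f n) x) ∧ (∀ n x, 0 ≤ f n x ∧ f n x ≤ 1) ∧
      TendstoL1loc m Ω f (E.indicator fun _ => 1) ∧
      ∀ n, ∫⁻ x in Ω, mSlope (f n) x ∂m < c := by
  simp only [Per, totVar, iInf_lt_iff] at h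
  obtain ⟨Ω', hΩ', hA, fn, h1, h2, h3⟩ := h
  have hfreq : ∃ᶠ n in atTop, ∫⁻ x in Ω', slopeOn Ω' (fn n) x ∂m < c :=
    frequently_lt_of_liminf_lt (by isBoundedDefault) h3
  obtain ⟨φ, hφ, hφc⟩ := extraction_of_frequently_atTop hfreq
  have htr : ∀ a b : ℝ, |max 0 (min a 1) - max 0 (min b 1)| ≤ |a - b| := fun a b => by
    refine (abs_max_sub_max_le_max _ _ _ _).trans (max_le (by simp) ?_)
    refine (abs_min_sub_min_le_max _ _ _ _).trans (max_le le_rfl (by simp))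
  refine ⟨fun n x => max 0 (min (fn (φ n) x) 1), fun n x hx => ?_, fun n x => ?_, ?_, fun n => ?_⟩
  · exact ((locLipOn_iff hΩ').1 (h1 (φ n)) x (hA hx)).of_abs_le fun y z => htr _ _
  · exact ⟨le_max_left _ _, max_le zero_le_one (min_le_right _ _)⟩
  · intro K hK hKc
    have ht := (h2 K (hK.trans hA) hKc).comp hφ.tendsto_atTop
    refine tendsto_of_tendsto_of_tendsto_of_le_of_le tendsto_const_nhds ht (fun _ => bot_le)
      fun n => lintegral_mono fun x => ENNReal.ofReal_le_ofReal ?_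
    have : E.indicator (fun _ => (1 : ℝ)) x = max 0 (min (E.indicator (fun _ => (1 : ℝ)) x) 1) := by
      by_cases hx : x ∈ E <;> simp [hx]
    conv_lhs => rw [this]
    exact htr _ _
  · refine lt_of_le_of_lt ?_ (hφc n)
    refine (lintegral_mono fun x => ?_).trans
      ((lintegral_mono_set hA).trans (setLIntegral_congr_fun (g := slopeOn Ω' (fn (φ n)))
        hΩ'.measurableSet fun x hx => (slopeOn_eq_mSlope hΩ' hx _).symm).le)
    exact mSlope_mono (Eventually.of_forall fun y => htr _ _)

theorem tendstoL1loc_compl {Ω E : Set X} {f : ℕ → X → ℝ}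
    (h : TendstoL1loc m Ω f (E.indicator fun _ => 1)) :
    TendstoL1loc m Ω (fun n x => 1 - f n x) (Eᶜ.indicator fun _ => 1) := by
  intro K hK hKc
  refine (h K hK hKc).congr fun n => lintegral_congr fun x => ?_
  congr 1
  by_cases hx : x ∈ E <;> simp [hx, abs_sub_comm]

theorem Per_compl_le [BorelSpace X] (E A : Set X) : Per m Eᶜ A ≤ Per m E A := by
  refine le_of_forall_gt fun c hc => ?_
  obtain ⟨U, hU, hAU, hc'⟩ := exists_isOpen_Per_lt hc
  obtain ⟨d, hd, hdc⟩ := exists_between hc'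
  obtain ⟨f, hf, -, hlim, hlt⟩ := exists_approx hd
  refine lt_of_le_of_lt ?_ hdc
  refine Per_le_of_forall_le (f := fun n x => 1 - f n x) (e := fun _ => 0) hU hAU ?_
    (tendstoL1loc_compl hlim) tendsto_const_nhds fun n => ?_
  · exact fun n x hx => (hf n x hx).of_abs_le fun y z => by
      rw [abs_sub_comm (f n y)]; simp
  · rw [add_zero]
    refine le_trans (lintegral_mono fun x => mSlope_mono ?_) (hlt n).le
    refine Eventually.of_forall fun y => ?_
    rw [abs_sub_comm (f n x)]; simp

theorem Per_compl [BorelSpace X] (E A : Set X) : Per m Eᶜ A = Per m E A :=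
  le_antisymm (Per_compl_le E A) (by simpa using Per_compl_le (m := m) Eᶜ A)

theorem aemeasurable_ofReal_abs_sub_indicator [BorelSpace X] {E Ω K : Set X} (hE : MeasurableSet E)
    (hΩ : IsOpen Ω) {f : X → ℝ} (hf : ∀ x ∈ Ω, LipNear f x) (hK : K ⊆ Ω) :
    AEMeasurable (fun x => ENNReal.ofReal |f x - E.indicator (fun _ => 1) x|) (m.restrict K) := by
  have h1 : AEMeasurable f (m.restrict K) :=
    (aemeasurable_of_lipNear hΩ hf).mono_measure (Measure.restrict_mono hK le_rfl)
  have h2 : AEMeasurable (E.indicator fun _ => (1 : ℝ)) (m.restrict K) :=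
    (measurable_const.indicator hE).aemeasurable
  exact (continuous_abs.measurable.comp_aemeasurable (h1.sub h2)).ennreal_ofReal

theorem Per_inter_le [BorelSpace X] {E : Set X} (hEm : MeasurableSet E) (F A : Set X) :
    Per m (E ∩ F) A ≤ Per m E A + Per m F A := by
  by_cases hE : Per m E A = ∞
  · simp [hE]
  by_cases hF : Per m F A = ∞
  · simp [hF]
  refine ENNReal.le_of_forall_pos_le_add fun ε hε _ => ?_
  have hε2 : (ε : ℝ≥0∞) / 2 ≠ 0 := by simp [hε.ne']
  obtain ⟨U, hU, hAU, hcU⟩ := exists_isOpen_Per_lt (ENNReal.lt_add_right hE hε2)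
  obtain ⟨V, hV, hAV, hcV⟩ := exists_isOpen_Per_lt (ENNReal.lt_add_right hF hε2)
  obtain ⟨f, hf, hf01, hflim, hflt⟩ := exists_approx hcU
  obtain ⟨g, hg, hg01, hglim, hglt⟩ := exists_approx hcV
  have hUV := hU.inter hV
  refine Per_le_of_forall_le (f := fun n x => f n x * g n x) (e := fun _ => 0) hUV
    (subset_inter hAU hAV) (fun n x hx => (hf n x hx.1).mul (hg n x hx.2)) ?_
    tendsto_const_nhds fun n => ?_
  · intro K hK hKc
    have h1 := hflim K (hK.trans inter_subset_left) hKc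
    have h2 := hglim K (hK.trans inter_subset_right) hKc
    have h3 := h1.add h2
    rw [add_zero] at h3
    refine tendsto_of_tendsto_of_tendsto_of_le_of_le tendsto_const_nhds h3 (fun _ => bot_le)
      fun n => ?_
    rw [← lintegral_add_left' (aemeasurable_ofReal_abs_sub_indicator hEm hU (hf n)
      (hK.trans inter_subset_left))]
    refine lintegral_mono fun x => ?_
    simp only
    rw [← ENNReal.ofReal_add (abs_nonneg _) (abs_nonneg _)]
    refine ENNReal.ofReal_le_ofReal ?_
    have e1 : (E ∩ F).indicator (fun _ => (1 : ℝ)) x =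
        E.indicator (fun _ => 1) x * F.indicator (fun _ => 1) x := by
      by_cases h1 : x ∈ E <;> by_cases h2 : x ∈ F <;> simp [h1, h2]
    have e2 : |F.indicator (fun _ => (1 : ℝ)) x| ≤ 1 := by
      by_cases h2 : x ∈ F <;> simp [h2]
    rw [e1]
    generalize E.indicator (fun _ => (1 : ℝ)) x = a at *
    generalize F.indicator (fun _ => (1 : ℝ)) x = b at *
    have e3 : f n x * g n x - a * b = (f n x - a) * b + f n x * (g n x - b) := by ring
    rw [e3]
    refine (abs_add_le _ _).trans ?_
    rw [abs_mul, abs_mul, abs_of_nonneg (hf01 n x).1]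
    exact add_le_add (mul_le_of_le_one_right (abs_nonneg _) e2)
      (mul_le_of_le_one_left (abs_nonneg _) (hf01 n x).2)
  · rw [add_zero]
    have h1 : ∫⁻ x in U ∩ V, mSlope (f n) x ∂m ≤ Per m E A + ε / 2 :=
      (lintegral_mono_set inter_subset_left).trans (hflt n).le
    have h2 : ∫⁻ x in U ∩ V, mSlope (g n) x ∂m ≤ Per m F A + ε / 2 :=
      (lintegral_mono_set inter_subset_right).trans (hglt n).le
    calc ∫⁻ x in U ∩ V, mSlope (fun x => f n x * g n x) x ∂m
        ≤ ∫⁻ x in U ∩ V, (mSlope (f n) x + mSlope (g n) x) ∂m := by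
          refine setLIntegral_mono' hUV.measurableSet fun x hx => ?_
          refine (mSlope_mul_le (hf n x hx.1).continuousAt (hg n x hx.2).mSlope_ne_top).trans ?_
          rw [add_comm]
          refine add_le_add (mul_le_of_le_one_left bot_le ?_) (mul_le_of_le_one_left bot_le ?_)
          · rw [ENNReal.ofReal_le_one, abs_of_nonneg (hg01 n x).1]; exact (hg01 n x).2
          · rw [ENNReal.ofReal_le_one, abs_of_nonneg (hf01 n x).1]; exact (hf01 n x).2
      _ = ∫⁻ x in U ∩ V, mSlope (f n) x ∂m + ∫⁻ x in U ∩ V, mSlope (g n) x ∂m :=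
          lintegral_add_left' (aemeasurable_mSlope hUV fun x hx => hf n x hx.1) _
      _ ≤ (Per m E A + ε / 2) + (Per m F A + ε / 2) := add_le_add h1 h2
      _ = Per m E A + Per m F A + (ε / 2 + ε / 2) := by ring
      _ = _ := by rw [ENNReal.add_halves]

theorem le_liminf_finset_sum {ι : Type*} (S : Finset ι) (u : ι → ℕ → ℝ≥0∞) :
    ∑ i ∈ S, liminf (u i) atTop ≤ liminf (fun n => ∑ i ∈ S, u i n) atTop := by
  classical
  induction S using Finset.induction_on with
  | empty => simp
  | insert a s ha ih =>
    simp only [Finset.sum_insert ha]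
    exact (add_le_add le_rfl ih).trans (ENNReal.add_liminf_le _ _)

theorem sum_Per_le [BorelSpace X] {ι : Type*} (E : Set X) (S : Finset ι) (V : ι → Set X) {Ω : Set X}
    (hV : ∀ i ∈ S, IsOpen (V i)) (hΩ : IsOpen Ω) (hVΩ : ∀ i ∈ S, V i ⊆ Ω) {N : ℕ}
    (hN : ∀ x, ((S : Set ι) ∩ {i | x ∈ V i}).encard ≤ N) :
    ∑ i ∈ S, Per m E (V i) ≤ N * Per m E Ω := by
  by_cases hN0 : N = 0
  · subst hN0
    refine le_of_eq_of_le (Finset.sum_eq_zero fun i hi => ?_) bot_le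
    have : V i = ∅ := by
      by_contra hne
      obtain ⟨x, hx⟩ := nonempty_iff_ne_empty.2 hne
      have := hN x
      simp only [Nat.cast_zero, nonpos_iff_eq_zero, encard_eq_zero] at this
      exact (this.subset ⟨hi, hx⟩ : i ∈ (∅ : Set ι))
    rw [this, Per_empty]
  by_cases htop : Per m E Ω = ∞
  · rw [htop, ENNReal.mul_top (by exact_mod_cast hN0)]; exact le_top
  refine ENNReal.le_of_forall_pos_le_add fun ε hε _ => ?_
  have hεN : (ε : ℝ≥0∞) / N ≠ 0 := by simp [hε.ne']
  obtain ⟨f, hf, -, hlim, hlt⟩ := exists_approx (ENNReal.lt_add_right htop hεN)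
  calc ∑ i ∈ S, Per m E (V i)
      ≤ ∑ i ∈ S, liminf (fun n => ∫⁻ x in V i, mSlope (f n) x ∂m) atTop :=
        Finset.sum_le_sum fun i hi => Per_le_liminf (hV i hi) Subset.rfl
          (fun n x hx => hf n x (hVΩ i hi hx)) (hlim.mono (hVΩ i hi))
    _ ≤ liminf (fun n => ∑ i ∈ S, ∫⁻ x in V i, mSlope (f n) x ∂m) atTop :=
        le_liminf_finset_sum _ _
    _ ≤ liminf (fun _ : ℕ => N * (Per m E Ω + ε / N)) atTop := by
        refine liminf_le_liminf (Eventually.of_forall fun n => ?_)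
        refine (sum_setLIntegral_le S V (fun i hi => (hV i hi).measurableSet) hΩ.measurableSet
          hVΩ hN _).trans ?_
        gcongr
        exact (hlt n).le
    _ = N * Per m E Ω + ε := by
        rw [liminf_const, mul_add, ENNReal.mul_div_cancel (by exact_mod_cast hN0) (by simp)]

end Approx

section Cutoff

variable [MetricSpace X] [MeasurableSpace X] [BorelSpace X] {m : Measure X}

/-- Energy estimate for the product of an approximating function with a cut-off. -/
theorem lintegral_mSlope_mul_cutoff_add_le {E Ω V Q : Set X} (hE : MeasurableSet E)
    (hΩ : IsOpen Ω) (hV : IsOpen V) (hVΩ : V ⊆ Ω) (hQ : IsClosed Q) {φ f : X → ℝ} {K : NNReal}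
    (hφ : LipschitzWith K φ) (hφ01 : ∀ x, 0 ≤ φ x ∧ φ x ≤ 1) (hφV : ∀ x ∈ V, φ x = 0)
    (hφQ : ∀ x ∉ Q, φ x = 1) (hf : ∀ x ∈ Ω, LipNear f x) :
    ∫⁻ x in Ω, mSlope (fun y => φ y * f y) x ∂m + ∫⁻ x in V, mSlope f x ∂m ≤
      ∫⁻ x in Ω, mSlope f x ∂m +
        (K * ∫⁻ x in Q, ENNReal.ofReal |f x - E.indicator (fun _ => 1) x| ∂m +
          ∫⁻ x in E ∩ Q, mSlope φ x ∂m) := by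
  set χ : X → ℝ := E.indicator fun _ => 1
  have hmφ : Measurable (mSlope φ) := by
    have := measurable_mSlope_indicator isOpen_univ hφ.continuous.continuousOn
    rwa [indicator_univ] at this
  have h1 : ∫⁻ x in V, mSlope f x ∂m = ∫⁻ x in Ω, V.indicator (mSlope f) x ∂m := by
    rw [lintegral_indicator hV.measurableSet, Measure.restrict_restrict hV.measurableSet,
      inter_eq_left.2 hVΩ]
  rw [h1]
  refine (le_lintegral_add _ _).trans ?_
  calc ∫⁻ x in Ω, (mSlope (fun y => φ y * f y) x + V.indicator (mSlope f) x) ∂m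
      ≤ ∫⁻ x in Ω, (mSlope f x + Q.indicator (fun x => K * ENNReal.ofReal |f x - χ x| +
          E.indicator (mSlope φ) x) x) ∂m := by
        refine setLIntegral_mono' hΩ.measurableSet fun x hx => ?_
        have hprod := mSlope_mul_le (hφ.continuous.continuousAt (x := x)) (hf x hx).mSlope_ne_top
        have hA : ENNReal.ofReal |f x| * mSlope φ x ≤ Q.indicator
            (fun x => K * ENNReal.ofReal |f x - χ x| + E.indicator (mSlope φ) x) x := by
          by_cases hxQ : x ∈ Q
          · rw [indicator_of_mem hxQ]
            have h2 : ENNReal.ofReal |f x| ≤ ENNReal.ofReal |f x - χ x| + ENNReal.ofReal |χ x| := by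
              rw [← ENNReal.ofReal_add (abs_nonneg _) (abs_nonneg _)]
              refine ENNReal.ofReal_le_ofReal ?_
              simpa using abs_add_le (f x - χ x) (χ x)
            refine (mul_le_mul_left h2 _).trans ?_
            rw [add_mul]
            refine add_le_add ?_ ?_
            · rw [mul_comm]
              exact mul_le_mul_left (hφ.mSlope_le x) _
            · by_cases hxE : x ∈ E <;> simp [χ, hxE]
          · have : mSlope φ x = 0 := mSlope_eq_zero_of_eventuallyEq_const (c := 1)
              (by filter_upwards [hQ.isOpen_compl.mem_nhds hxQ] with y hy using hφQ y hy)
            simp [this]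
        by_cases hxV : x ∈ V
        · have : mSlope (fun y => φ y * f y) x = 0 :=
            mSlope_eq_zero_of_eventuallyEq_const (c := 0)
              (by filter_upwards [hV.mem_nhds hxV] with y hy; simp [hφV y hy])
          rw [this, indicator_of_mem hxV, zero_add]
          exact le_self_add
        · rw [indicator_of_notMem hxV, add_zero]
          refine hprod.trans (add_le_add (mul_le_of_le_one_left bot_le ?_) hA)
          rw [ENNReal.ofReal_le_one, abs_of_nonneg (hφ01 x).1]; exact (hφ01 x).2
    _ = ∫⁻ x in Ω, mSlope f x ∂m + ∫⁻ x in Ω, Q.indicator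
          (fun x => K * ENNReal.ofReal |f x - χ x| + E.indicator (mSlope φ) x) x ∂m :=
        lintegral_add_left' (aemeasurable_mSlope hΩ hf) _
    _ ≤ _ := by
        refine add_le_add le_rfl ((setLIntegral_le_lintegral _ _).trans ?_)
        rw [lintegral_indicator hQ.measurableSet, lintegral_add_right _ (hmφ.indicator hE),
          lintegral_const_mul' _ _ (by simp), lintegral_indicator hE,
          Measure.restrict_restrict hE]

/-- If cut-off functions vanish near sets `V k` and are trivial outside sets on which the mass of
`E` tends to zero, then the perimeter of `E` in `V k` is asymptotically controlled by the energy
of the cut-offs on `E`. -/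
theorem not_forall_cutoff_energy_lt [IsFiniteMeasureOnCompacts m] {E Ω : Set X}
    (hE : MeasurableSet E) (hΩ : IsOpen Ω) (hfin : Per m E Ω ≠ ∞) {V Q : ℕ → Set X}
    (hV : ∀ k, IsOpen (V k)) (hVΩ : ∀ k, V k ⊆ Ω) (hQ : ∀ k, IsCompact (Q k))
    (hQΩ : ∀ k, Q k ⊆ Ω) {φ : ℕ → X → ℝ} {K : ℕ → NNReal} (hφ : ∀ k, LipschitzWith (K k) (φ k))
    (hφ01 : ∀ k x, 0 ≤ φ k x ∧ φ k x ≤ 1) (hφV : ∀ k, ∀ x ∈ V k, φ k x = 0)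
    (hφQ : ∀ k, ∀ x ∉ Q k, φ k x = 1) (hlim : Tendsto (fun k => m (E ∩ Q k)) atTop (𝓝 0))
    {ε : ℝ≥0∞} (hε : ε ≠ 0) :
    ¬ ∀ k, ∫⁻ x in E ∩ Q k, mSlope (φ k) x ∂m + ε ≤ Per m E (V k) := by
  intro H
  have hVfin : ∀ k, Per m E (V k) ≠ ∞ := fun k => ne_top_of_le_ne_top hfin (Per_mono E (hVΩ k))
  have hεtop : ε ≠ ∞ := ne_top_of_le_ne_top (hVfin 0) (le_add_self.trans (H 0))
  obtain ⟨δ, hδ⟩ : ∃ δ, δ = ε / 4 := ⟨_, rfl⟩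
  have hδ0 : δ ≠ 0 := by simp [hδ, hε]
  have hδtop : δ ≠ ∞ := by rw [hδ]; exact (ENNReal.div_lt_top hεtop (by simp)).ne
  have hδε : ε = δ + δ + δ + δ := by
    have : δ + δ + δ + δ = 4 * δ := by ring
    rw [this, hδ, ENNReal.mul_div_cancel (by simp) (by simp)]
  obtain ⟨f, hf, hf01, hflim, hflt⟩ := exists_approx (ENNReal.lt_add_right hfin hδ0)
  set P := Per m E Ω
  have key : ∀ k, ∃ n ≥ k, ∫⁻ x in Ω, mSlope (fun y => φ k y * f n y) x ∂m + δ ≤ P := by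
    intro k
    set a := ∫⁻ x in E ∩ Q k, mSlope (φ k) x ∂m
    have hak : a ≠ ∞ := ne_top_of_le_ne_top (hVfin k) (le_self_add.trans (H k))
    have h1 : a + (δ + δ + δ) < liminf (fun n => ∫⁻ x in V k, mSlope (f n) x ∂m) atTop := by
      refine lt_of_lt_of_le ?_ (Per_le_liminf (hV k) Subset.rfl
        (fun n x hx => hf n x (hVΩ k hx)) (hflim.mono (hVΩ k)))
      refine lt_of_lt_of_le ?_ (H k)
      rw [hδε, show a + (δ + δ + δ + δ) = a + (δ + δ + δ) + δ by ring]
      exact ENNReal.lt_add_right (by simp [hak, hδtop]) hδ0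
    have h2 : Tendsto (fun n => (K k : ℝ≥0∞) *
        ∫⁻ x in Q k, ENNReal.ofReal |f n x - E.indicator (fun _ => 1) x| ∂m) atTop (𝓝 0) := by
      have := ENNReal.Tendsto.const_mul (a := (K k : ℝ≥0∞)) (hflim (Q k) (hQΩ k) (hQ k))
        (Or.inr coe_ne_top)
      rwa [mul_zero] at this
    obtain ⟨n, hn1, hn2, hnk⟩ := ((eventually_lt_of_lt_liminf h1).and
      ((h2.eventually (gt_mem_nhds (pos_iff_ne_zero.2 hδ0))).and (eventually_ge_atTop k))).exists
    refine ⟨n, hnk, ?_⟩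
    have h3 := lintegral_mSlope_mul_cutoff_add_le (m := m) hE hΩ (hV k) (hVΩ k) (hQ k).isClosed
      (hφ k) (hφ01 k) (hφV k) (hφQ k) (hf n)
    have h4 : ∫⁻ x in Ω, mSlope (fun y => φ k y * f n y) x ∂m + δ + (a + δ + δ) ≤
        P + (a + δ + δ) := by
      calc _ = ∫⁻ x in Ω, mSlope (fun y => φ k y * f n y) x ∂m + (a + (δ + δ + δ)) := by ring
        _ ≤ _ := add_le_add le_rfl hn1.le
        _ ≤ _ := h3
        _ ≤ (P + δ) + (δ + a) := add_le_add (hflt n).le (add_le_add hn2.le le_rfl)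
        _ = _ := by ring
    exact (ENNReal.add_le_add_iff_right (by simp [hak, hδtop])).1 h4
  choose n hnk hn using key
  have hge : Tendsto n atTop atTop := tendsto_atTop_mono hnk tendsto_id
  have hP : P ≤ P - δ := by
    refine (Per_le_liminf (f := fun k y => φ k y * f (n k) y) hΩ Subset.rfl
      (fun k x hx => ((hφ k).lipNear x).mul (hf _ x hx)) ?_).trans ?_
    · intro C hC hCc
      have h1 := ((hflim C hC hCc).comp hge).add hlim
      rw [add_zero] at h1
      refine tendsto_of_tendsto_of_tendsto_of_le_of_le tendsto_const_nhds h1 (fun _ => bot_le)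
        fun k => ?_
      have h2 : m (E ∩ Q k) = ∫⁻ x, (E ∩ Q k).indicator 1 x ∂m :=
        (lintegral_indicator_one (hE.inter (hQ k).isClosed.measurableSet)).symm
      simp only [Function.comp_apply]
      rw [h2]
      refine le_trans ?_ (add_le_add le_rfl (setLIntegral_le_lintegral C _))
      rw [← lintegral_add_left' (aemeasurable_ofReal_abs_sub_indicator hE hΩ (hf (n k)) hC)]
      refine lintegral_mono fun x => ?_
      simp only
      have h5 := hφ01 k x
      by_cases hxE : x ∈ E
      · by_cases hxQ : x ∈ Q k
        · have h3 : (E ∩ Q k).indicator (1 : X → ℝ≥0∞) x = ENNReal.ofReal 1 := by simp [hxE, hxQ]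
          rw [h3, ← ENNReal.ofReal_add (abs_nonneg _) zero_le_one]
          refine ENNReal.ofReal_le_ofReal ?_
          have h4 : φ k x * f (n k) x - E.indicator (fun _ => 1) x =
            φ k x * (f (n k) x - E.indicator (fun _ => 1) x) +
              (φ k x - 1) * E.indicator (fun _ => 1) x := by ring
          rw [h4]
          refine (abs_add_le _ _).trans ?_
          rw [abs_mul, abs_mul, abs_of_nonneg h5.1]
          refine add_le_add (mul_le_of_le_one_left (abs_nonneg _) h5.2) ?_
          rw [indicator_of_mem hxE, abs_one, mul_one, abs_le]
          constructor <;> linarith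
        · simp [hφQ k x hxQ]
      · refine le_trans (ENNReal.ofReal_le_ofReal ?_) le_self_add
        rw [indicator_of_notMem hxE, sub_zero, sub_zero, abs_mul, abs_of_nonneg h5.1]
        exact mul_le_of_le_one_left (abs_nonneg _) h5.2
    · have : ∀ k, ∫⁻ x in Ω, mSlope (fun y => φ k y * f (n k) y) x ∂m ≤ P - δ := fun k =>
        ENNReal.le_sub_of_add_le_right hδtop (hn k)
      refine (liminf_le_liminf (Eventually.of_forall this)).trans ?_
      rw [liminf_const]
  have hδP : δ ≤ P := le_add_self.trans (hn 0)
  have hP0 : P ≠ 0 := fun h => hδ0 (by simpa [h] using hδP)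
  exact absurd hP (not_le.2 (ENNReal.sub_lt_self hfin hP0 hδ0))

end Cutoff

section Partition

/-- Locally Lipschitz partitions of unity subordinate to a family of open sets in a proper
space. -/
theorem exists_lipNear_partition.{u, v} {X : Type u} [MetricSpace X] [ProperSpace X] {ι : Type v} {Ω : ι → Set X}
    (hΩ : ∀ i, IsOpen (Ω i)) :
    ∃ (α : Type u) (_ : Countable α) (i : α → ι) (K : α → Set X) (φ : α → X → ℝ),
      (∀ a, IsCompact (K a) ∧ K a ⊆ Ω (i a)) ∧ (∀ a x, 0 ≤ φ a x) ∧ (∀ a, ∀ x ∉ K a, φ a x = 0) ∧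
      (∀ a, ∀ x ∈ ⋃ i, Ω i, LipNear (φ a) x) ∧
      ∀ x ∈ ⋃ i, Ω i, ∃ s : Finset α, ∀ᶠ y in 𝓝 x, (∀ a ∉ s, φ a y = 0) ∧ ∑ a ∈ s, φ a y = 1 := by
  classical
  set U := ⋃ i, Ω i with hU
  have hUo : IsOpen U := isOpen_iUnion hΩ
  have h1 : ∀ x : U, ∃ i, ∃ R > 0, closedBall (x : X) R ⊆ Ω i := by
    rintro ⟨x, hx⟩
    obtain ⟨i, hi⟩ := mem_iUnion.1 hx
    obtain ⟨R, hR, h⟩ := nhds_basis_closedBall.mem_iff.1 ((hΩ i).mem_nhds hi)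
    exact ⟨i, R, hR, h⟩
  choose j R hR hj using h1
  have : LocallyCompactSpace U := hUo.locallyCompactSpace
  have hbasis : ∀ x : U, (𝓝 x).HasBasis (fun r : ℝ => 0 < r ∧ r < R x) (ball x) := fun x =>
    nhds_basis_ball.restrict fun r hr => ⟨min r (R x / 2), lt_min hr (half_pos (hR x)),
      (min_le_right _ _).trans_lt (half_lt_self (hR x)), ball_subset_ball (min_le_left _ _)⟩
  obtain ⟨α, c, r, hr, hcov, hfin⟩ := refinement_of_locallyCompact_sigmaCompact_of_nhds_basis hbasis
  have hcount : Countable α := by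
    have := hfin.countable_univ fun a => ⟨c a, mem_ball_self (hr a).1⟩
    exact countable_univ_iff.1 this
  let ψ : α → X → ℝ := fun a y => max 0 (r a - dist y (c a))
  have hψ0 : ∀ a y, 0 ≤ ψ a y := fun a y => le_max_left _ _
  have hψK : ∀ a y, y ∉ ball (c a : X) (r a) → ψ a y = 0 := fun a y hy =>
    max_eq_left (by rw [mem_ball, not_lt] at hy; linarith)
  have hψL : ∀ a y, LipNear (ψ a) y := fun a y => by
    have h : LipschitzWith 1 fun y : X => r a - dist y (c a) := by
      refine LipschitzWith.of_dist_le_mul fun y z => ?_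
      rw [NNReal.coe_one, one_mul, dist_sub_left]
      simpa using (LipschitzWith.dist_left (c a : X)).dist_le_mul y z
    exact (h.const_max 0).lipNear y
  have hloc : ∀ x ∈ U, ∃ s : Finset α, ∀ᶠ y in 𝓝 x, ∀ a ∉ s, ψ a y = 0 := by
    intro x hx
    obtain ⟨t, ht, hts⟩ := hfin ⟨x, hx⟩
    refine ⟨hts.toFinset, ?_⟩
    filter_upwards [hUo.isOpenEmbedding_subtypeVal.isOpenMap.image_mem_nhds ht]
    rintro y ⟨z, hz, rfl⟩ a ha
    refine hψK a _ fun hy => ha ?_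
    rw [Finite.mem_toFinset]
    exact ⟨z, hy, hz⟩
  have hpos : ∀ x ∈ U, ∃ a, 0 < ψ a x := by
    intro x hx
    have : (⟨x, hx⟩ : U) ∈ ⋃ a, ball (c a) (r a) := hcov ▸ mem_univ _
    obtain ⟨a, ha⟩ := mem_iUnion.1 this
    refine ⟨a, lt_max_of_lt_right ?_⟩
    have : dist x (c a) < r a := ha
    linarith
  let S : X → ℝ := fun y => ∑ᶠ a, ψ a y
  have hS : ∀ (s : Finset α) y, (∀ a ∉ s, ψ a y = 0) → S y = ∑ a ∈ s, ψ a y := fun s y h =>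
    finsum_eq_sum_of_support_subset _ fun a ha => by
      by_contra hs
      exact ha (h a hs)
  have hSpos : ∀ x ∈ U, 0 < S x := by
    intro x hx
    obtain ⟨s, hs⟩ := hloc x hx
    have hs := hs.self_of_nhds
    obtain ⟨a, ha⟩ := hpos x hx
    rw [hS s x hs]
    refine Finset.sum_pos' (fun a _ => hψ0 a x) ⟨a, ?_, ha⟩
    by_contra h
    exact ha.ne' (hs a h)
  refine ⟨α, hcount, fun a => j (c a), fun a => closedBall (c a) (r a),
    fun a y => ψ a y * (S y)⁻¹, fun a => ⟨isCompact_closedBall _ _, ?_⟩, fun a x => ?_, fun a x hx => ?_,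
    fun a x hx => ?_, fun x hx => ?_⟩
  · exact (closedBall_subset_closedBall (hr a).2.le).trans (hj _)
  · exact mul_nonneg (hψ0 a x) (inv_nonneg.2 (finsum_nonneg fun a => hψ0 a x))
  · change ψ a x * (S x)⁻¹ = 0
    rw [hψK a x fun h => hx (ball_subset_closedBall h), zero_mul]
  · refine (hψL a x).mul (LipNear.inv ?_ (hSpos x hx))
    obtain ⟨s, hs⟩ := hloc x hx
    refine (LipNear.sum s fun a _ => hψL a x).congr ?_
    filter_upwards [hs] with y hy
    exact (hS s y hy).symm
  · obtain ⟨s, hs⟩ := hloc x hx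
    refine ⟨s, ?_⟩
    filter_upwards [hs, hUo.mem_nhds hx] with y hy hyU
    refine ⟨fun a ha => by rw [hy a ha, zero_mul], ?_⟩
    rw [← Finset.sum_mul, ← hS s y hy, mul_inv_cancel₀ (hSpos y hyU).ne']

theorem LipNear.eventually_mSlope_le [MetricSpace X] {f : X → ℝ} {x : X} (h : LipNear f x) :
    ∃ K : NNReal, ∀ᶠ y in 𝓝 x, mSlope f y ≤ K := by
  obtain ⟨K, s, hs, hK⟩ := h
  refine ⟨K, ?_⟩
  filter_upwards [eventually_mem_nhds_iff.2 hs] with y hy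
  have := mSlope_le_ofReal (f := f) (x := y) (K := K) (by
    filter_upwards [hy] with z hz
    simpa [Real.dist_eq] using hK.dist_le_mul y (mem_of_mem_nhds hy) z hz)
  simpa using this

theorem IsCompact.exists_mSlope_le [MetricSpace X] {f : X → ℝ} {K : Set X} (hK : IsCompact K)
    (hf : ∀ x ∈ K, LipNear f x) : ∃ C : NNReal, ∀ x ∈ K, mSlope f x ≤ C := by
  refine hK.induction_on ⟨0, by simp⟩ (fun s t hst ⟨C, h⟩ => ⟨C, fun x hx => h x (hst hx)⟩) ?_ ?_
  · rintro s t ⟨C, h⟩ ⟨C', h'⟩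
    refine ⟨max C C', fun x hx => ?_⟩
    rw [ENNReal.coe_max]
    exact hx.elim (fun hx => le_max_of_le_left (h x hx)) fun hx => le_max_of_le_right (h' x hx)
  · intro x hx
    obtain ⟨C, hC⟩ := (hf x hx).eventually_mSlope_le
    exact ⟨_, mem_nhdsWithin_of_mem_nhds hC, C, fun y hy => hy⟩

/-- Gluing of locally Lipschitz functions by a partition of unity. -/
theorem mSlope_glue_le [MetricSpace X] {α : Type*} {U : Set X} {K : α → Set X} {φ : α → X → ℝ}
    (hφ0 : ∀ a x, 0 ≤ φ a x) (hK : ∀ a, IsClosed (K a)) (hφK : ∀ a, ∀ x ∉ K a, φ a x = 0)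
    (hφ : ∀ a, ∀ x ∈ U, LipNear (φ a) x)
    (hφ1 : ∀ x ∈ U, ∃ s : Finset α, ∀ᶠ y in 𝓝 x, (∀ a ∉ s, φ a y = 0) ∧ ∑ a ∈ s, φ a y = 1)
    {C : α → NNReal} (hC : ∀ a, ∀ x ∈ K a, mSlope (φ a) x ≤ C a)
    {f : α → X → ℝ} (hf : ∀ a, ∀ x ∈ K a, LipNear (f a) x) (χ : X → ℝ) {x : X} (hx : x ∈ U) :
    LipNear (fun y => ∑ᶠ a, φ a y * f a y) x ∧
    ENNReal.ofReal |∑ᶠ a, φ a x * f a x - χ x| ≤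
      ∑' a, (K a).indicator (fun x => ENNReal.ofReal |f a x - χ x|) x ∧
    mSlope (fun y => ∑ᶠ a, φ a y * f a y) x ≤ ∑' a, (K a).indicator (fun x =>
      ENNReal.ofReal (φ a x) * mSlope (f a) x + C a * ENNReal.ofReal |f a x - χ x|) x := by
  obtain ⟨s, hs⟩ := hφ1 x hx
  have hnear : ∀ a, x ∉ K a → ∀ᶠ y in 𝓝 x, φ a y = 0 := fun a ha => by
    filter_upwards [(hK a).isOpen_compl.mem_nhds ha] with y hy using hφK a y hy
  have heq : (fun y => ∑ᶠ a, φ a y * f a y) =ᶠ[𝓝 x] fun y => ∑ a ∈ s, φ a y * f a y := by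
    filter_upwards [hs] with y hy
    refine finsum_eq_sum_of_support_subset _ fun a ha => ?_
    by_contra h
    exact ha (by simp [hy.1 a h])
  have hx1 := hs.self_of_nhds
  have hle1 : ∀ a, φ a x ≤ 1 := fun a => by
    by_cases ha : a ∈ s
    · rw [← hx1.2]
      exact Finset.single_le_sum (fun b _ => hφ0 b x) ha
    · rw [hx1.1 a ha]; exact zero_le_one
  refine ⟨?_, ?_, ?_⟩
  · refine (LipNear.sum s fun a _ => ?_).congr heq.symm
    by_cases ha : x ∈ K a
    · exact (hφ a x hx).mul (hf a x ha)
    · refine (lipNear_const 0 x).congr ?_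
      filter_upwards [hnear a ha] with y hy
      rw [hy, zero_mul]
  · have h1 : ∑ᶠ a, φ a x * f a x - χ x = ∑ a ∈ s, φ a x * (f a x - χ x) := by
      rw [show ∑ᶠ a, φ a x * f a x = ∑ a ∈ s, φ a x * f a x from heq.self_of_nhds]
      simp_rw [mul_sub]
      rw [Finset.sum_sub_distrib, ← Finset.sum_mul, hx1.2, one_mul]
    rw [h1]
    refine le_trans (ENNReal.ofReal_le_ofReal (Finset.abs_sum_le_sum_abs _ _)) ?_
    rw [ENNReal.ofReal_sum_of_nonneg fun a _ => abs_nonneg _]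
    refine le_trans (Finset.sum_le_sum fun a _ => ?_) (ENNReal.sum_le_tsum s)
    by_cases ha : x ∈ K a
    · rw [indicator_of_mem ha, abs_mul, abs_of_nonneg (hφ0 a x)]
      exact ENNReal.ofReal_le_ofReal (mul_le_of_le_one_left (abs_nonneg _) (hle1 a))
    · simp [hφK a x ha]
  · have h1 : mSlope (fun y => ∑ᶠ a, φ a y * f a y) x =
        mSlope (fun y => ∑ a ∈ s, φ a y * (f a y - χ x)) x := by
      rw [← mSlope_sub_const (fun y => ∑ᶠ a, φ a y * f a y) (χ x)]
      refine mSlope_congr ?_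
      filter_upwards [heq, hs] with y hy hsy
      rw [hy]
      simp_rw [mul_sub]
      rw [Finset.sum_sub_distrib, ← Finset.sum_mul, hsy.2, one_mul]
    rw [h1]
    refine (mSlope_sum_le _ _ _).trans (le_trans (Finset.sum_le_sum fun a _ => ?_)
      (ENNReal.sum_le_tsum s))
    by_cases ha : x ∈ K a
    · rw [indicator_of_mem ha]
      refine (mSlope_mul_le (hφ a x hx).continuousAt
        (by rw [mSlope_sub_const]; exact (hf a x ha).mSlope_ne_top)).trans ?_
      rw [mSlope_sub_const, abs_of_nonneg (hφ0 a x), mul_comm (ENNReal.ofReal |_|)]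
      gcongr
      exact hC a x ha
    · rw [mSlope_eq_zero_of_eventuallyEq_const (c := 0)]
      · exact zero_le
      · filter_upwards [hnear a ha] with y hy
        rw [hy, zero_mul]

end Partition

section Subadditivity

variable [MetricSpace X] [MeasurableSpace X] [BorelSpace X] {m : Measure X}

theorem exists_weighted_approx {E Ω : Set X} (hΩ : IsOpen Ω) {c : ℝ≥0∞} (h : Per m E Ω < c)
    {α : Type*} [Countable α] {φ : α → X → ℝ} (hφ0 : ∀ a x, 0 ≤ φ a x)
    (hφ : ∀ a, ∀ x ∈ Ω, LipNear (φ a) x) (hφ1 : ∀ S : Finset α, ∀ x ∈ Ω, ∑ a ∈ S, φ a x ≤ 1) :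
    ∃ (f : ℕ → X → ℝ) (L : α → ℝ≥0∞), (∀ n, ∀ x ∈ Ω, LipNear (f n) x) ∧
      TendstoL1loc m Ω f (E.indicator fun _ => 1) ∧
      (∀ a, Tendsto (fun n => ∫⁻ x in Ω, ENNReal.ofReal (φ a x) * mSlope (f n) x ∂m) atTop
        (𝓝 (L a))) ∧ ∑' a, L a ≤ c := by
  obtain ⟨f, hf, -, hflim, hflt⟩ := exists_approx h
  obtain ⟨L, σ, hσ, hL⟩ := CompactSpace.tendsto_subseq
    (fun n a => ∫⁻ x in Ω, ENNReal.ofReal (φ a x) * mSlope (f n) x ∂m)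
  rw [tendsto_pi_nhds] at hL
  refine ⟨fun n => f (σ n), L, fun n => hf _, fun K hK hKc =>
    (hflim K hK hKc).comp hσ.tendsto_atTop, hL, ?_⟩
  refine ENNReal.summable.tsum_le_of_sum_le fun S => ?_
  refine le_of_tendsto (tendsto_finsetSum S fun a _ => hL a) (Eventually.of_forall fun n => ?_)
  have hsum := lintegral_finsetSum' (μ := m.restrict Ω) S
    (f := fun a x => ENNReal.ofReal (φ a x) * mSlope (f (σ n)) x) fun a _ =>
      ((aemeasurable_of_lipNear hΩ (hφ a)).ennreal_ofReal.mul (aemeasurable_mSlope hΩ (hf _)))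
  refine hsum.symm.trans_le ?_
  refine le_trans (setLIntegral_mono' hΩ.measurableSet fun x hx => ?_) (hflt (σ n)).le
  rw [← Finset.sum_mul, ← ENNReal.ofReal_sum_of_nonneg fun a _ => hφ0 a x]
  exact mul_le_of_le_one_left' (ENNReal.ofReal_le_one.2 (hφ1 S x hx))

theorem Per_iUnion_le_of_isOpen [ProperSpace X] {E : Set X} (hE : MeasurableSet E)
    {Ω : ℕ → Set X} (hΩ : ∀ i, IsOpen (Ω i)) :
    Per m E (⋃ i, Ω i) ≤ ∑' i, Per m E (Ω i) := by
  refine ENNReal.le_of_forall_pos_le_add fun ε hε hlt => ?_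
  obtain ⟨e, he0, hesum⟩ := ENNReal.exists_pos_sum_of_countable' (ι := ℕ) (ε := ε)
    (by simpa using hε.ne')
  obtain ⟨α, _, i, K, φ, hK, hφ0, hφK, hφ, hφ1⟩ := exists_lipNear_partition hΩ
  set U := ⋃ i, Ω i with hU
  have hUo : IsOpen U := isOpen_iUnion hΩ
  have hΩU : ∀ i, Ω i ⊆ U := subset_iUnion Ω
  have hφle : ∀ S : Finset α, ∀ x ∈ U, ∑ a ∈ S, φ a x ≤ 1 := by
    classical
    intro S x hx
    obtain ⟨s, hs⟩ := hφ1 x hx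
    obtain ⟨h1, h2⟩ := hs.self_of_nhds
    rw [← h2]
    calc ∑ a ∈ S, φ a x ≤ ∑ a ∈ S ∪ s, φ a x :=
          Finset.sum_le_sum_of_subset_of_nonneg Finset.subset_union_left fun a _ _ => hφ0 a x
      _ = ∑ a ∈ s, φ a x :=
          (Finset.sum_subset Finset.subset_union_right fun a _ ha => h1 a ha).symm
  have hKU : ∀ a, K a ⊆ U := fun a => (hK a).2.trans (hΩU _)
  have hw : ∀ i, ∃ (f : ℕ → X → ℝ) (L : α → ℝ≥0∞), (∀ n, ∀ x ∈ Ω i, LipNear (f n) x) ∧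
      TendstoL1loc m (Ω i) f (E.indicator fun _ => 1) ∧
      (∀ a, Tendsto (fun n => ∫⁻ x in Ω i, ENNReal.ofReal (φ a x) * mSlope (f n) x ∂m) atTop
        (𝓝 (L a))) ∧ ∑' a, L a ≤ Per m E (Ω i) + e i := fun i =>
    exists_weighted_approx (hΩ i) (ENNReal.lt_add_right
      (ne_top_of_le_ne_top hlt.ne (ENNReal.le_tsum i)) (he0 i).ne') hφ0
      (fun a x hx => hφ a x (hΩU i hx)) fun S x hx => hφle S x (hΩU i hx)
  choose f L hf hflim hL hLsum using hw
  have hLtot : ∑' a, L (i a) a ≤ ∑' i, Per m E (Ω i) + ε := by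
    calc ∑' a, L (i a) a ≤ ∑' a, ∑' j, L j a :=
          ENNReal.tsum_le_tsum fun a => ENNReal.le_tsum (f := fun j => L j a) (i a)
      _ = ∑' j, ∑' a, L j a := ENNReal.tsum_comm
      _ ≤ ∑' j, (Per m E (Ω j) + e j) := ENNReal.tsum_le_tsum hLsum
      _ = ∑' j, Per m E (Ω j) + ∑' j, e j := ENNReal.tsum_add
      _ ≤ _ := by gcongr
  refine le_trans ?_ hLtot
  choose C hC using fun a => (hK a).1.exists_mSlope_le fun x hx => hφ a x (hKU a hx)
  have hη : ∀ k : ℕ, ∃ η : α → ℝ≥0∞, (∀ a, 0 < η a) ∧ ∑' a, η a < ((k : ℝ≥0∞) + 1)⁻¹ := fun k =>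
    ENNReal.exists_pos_sum_of_countable' (by
      rw [Ne, ENNReal.inv_eq_zero]; exact ENNReal.add_ne_top.2 ⟨by simp, by simp⟩) α
  choose η hη0 hηsum using hη
  have hLfin : ∀ a, L (i a) a ≠ ∞ := fun a => by
    refine ne_top_of_le_ne_top ?_ ((ENNReal.le_tsum (f := fun a => L (i a) a) a).trans hLtot)
    exact ENNReal.add_ne_top.2 ⟨hlt.ne, by simp⟩
  have hn : ∀ (k : ℕ) (a : α), ∃ n,
      ∫⁻ x in Ω (i a), ENNReal.ofReal (φ a x) * mSlope (f (i a) n) x ∂m ≤ L (i a) a + η k a ∧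
      C a * ∫⁻ x in K a, ENNReal.ofReal |f (i a) n x - E.indicator (fun _ => 1) x| ∂m ≤ η k a ∧
      ∫⁻ x in K a, ENNReal.ofReal |f (i a) n x - E.indicator (fun _ => 1) x| ∂m ≤ η k a := by
    intro k a
    have h1 := (hL (i a) a).eventually
      (gt_mem_nhds (ENNReal.lt_add_right (hLfin a) (hη0 k a).ne'))
    have h2 := hflim (i a) (K a) (hK a).2 (hK a).1
    have h3 := ENNReal.Tendsto.const_mul (a := (C a : ℝ≥0∞)) h2 (Or.inr coe_ne_top)
    rw [mul_zero] at h3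
    obtain ⟨n, h1, h2, h3⟩ := (h1.and ((h2.eventually (gt_mem_nhds (hη0 k a))).and
      (h3.eventually (gt_mem_nhds (hη0 k a))))).exists
    exact ⟨n, h1.le, h3.le, h2.le⟩
  choose n hn1 hn2 hn3 using hn
  have hglue := fun k => fun x (hx : x ∈ U) =>
    mSlope_glue_le (f := fun a => f (i a) (n k a)) hφ0 (fun a => (hK a).1.isClosed) hφK hφ hφ1 hC
      (fun a x hx => hf (i a) (n k a) x ((hK a).2 hx)) (E.indicator fun _ => 1) hx
  have hmeas1 : ∀ k a, AEMeasurable (fun x =>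
      ENNReal.ofReal |f (i a) (n k a) x - E.indicator (fun _ => 1) x|) (m.restrict (K a)) :=
    fun k a => aemeasurable_ofReal_abs_sub_indicator hE (hΩ (i a)) (hf (i a) (n k a)) (hK a).2
  have hmeas2 : ∀ k a, AEMeasurable (fun x => ENNReal.ofReal (φ a x) * mSlope (f (i a) (n k a)) x)
      (m.restrict (K a)) := fun k a =>
    ((aemeasurable_of_lipNear (hΩ (i a)) fun x hx => hφ a x (hΩU _ hx)).ennreal_ofReal.mul
      (aemeasurable_mSlope (hΩ (i a)) (hf _ _))).mono_measure (Measure.restrict_mono (hK a).2 le_rfl)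
  have hKm : ∀ a, MeasurableSet (K a) := fun a => (hK a).1.measurableSet
  have hind : ∀ (g : α → X → ℝ≥0∞), (∀ a, AEMeasurable (g a) (m.restrict (K a))) → ∀ A : Set X,
      ∫⁻ x in A, ∑' a, (K a).indicator (g a) x ∂m ≤ ∑' a, ∫⁻ x in K a, g a x ∂m := by
    intro g hg A
    refine (setLIntegral_le_lintegral _ _).trans ?_
    rw [lintegral_tsum fun a => (aemeasurable_indicator_iff (hKm a)).2 (hg a)]
    exact (tsum_congr fun a => lintegral_indicator (hKm a) _).le
  have hto0 : Tendsto (fun k : ℕ => ((k : ℝ≥0∞) + 1)⁻¹) atTop (𝓝 0) := by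
    have := (tendsto_add_atTop_iff_nat 1).2 ENNReal.tendsto_inv_nat_nhds_zero
    simpa using this
  refine Per_le_of_forall_le (f := fun k y => ∑ᶠ a, φ a y * f (i a) (n k a) y)
    (e := fun k : ℕ => ((k : ℝ≥0∞) + 1)⁻¹ + ((k : ℝ≥0∞) + 1)⁻¹) hUo Subset.rfl
    (fun k x hx => (hglue k x hx).1) ?_ (by simpa using hto0.add hto0) ?_
  · intro A hA hAc
    refine tendsto_of_tendsto_of_tendsto_of_le_of_le tendsto_const_nhds hto0
      (fun _ => zero_le) fun k => ?_
    calc _ ≤ ∫⁻ x in A, ∑' a, (K a).indicator (fun x =>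
            ENNReal.ofReal |f (i a) (n k a) x - E.indicator (fun _ => 1) x|) x ∂m :=
          setLIntegral_mono' hAc.measurableSet fun x hx => (hglue k x (hA hx)).2.1
      _ ≤ _ := hind _ (hmeas1 k) A
      _ ≤ ∑' a, η k a := ENNReal.tsum_le_tsum (hn3 k)
      _ ≤ _ := (hηsum k).le
  · intro k
    calc _ ≤ ∫⁻ x in U, ∑' a, (K a).indicator (fun x =>
            ENNReal.ofReal (φ a x) * mSlope (f (i a) (n k a)) x +
            C a * ENNReal.ofReal |f (i a) (n k a) x - E.indicator (fun _ => 1) x|) x ∂m :=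
          setLIntegral_mono' hUo.measurableSet fun x hx => (hglue k x hx).2.2
      _ ≤ _ := hind _ (fun a => (hmeas2 k a).add ((hmeas1 k a).const_mul _)) U
      _ ≤ ∑' a, (L (i a) a + (η k a + η k a)) := by
          refine ENNReal.tsum_le_tsum fun a => ?_
          change ∫⁻ x in K a, (ENNReal.ofReal (φ a x) * mSlope (f (i a) (n k a)) x +
            C a * ENNReal.ofReal |f (i a) (n k a) x - E.indicator (fun _ => 1) x|) ∂m ≤ _
          rw [lintegral_add_left' (hmeas2 k a), lintegral_const_mul' _ _ coe_ne_top, ← add_assoc]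
          exact add_le_add ((lintegral_mono_set (hK a).2).trans (hn1 k a)) (hn2 k a)
      _ = ∑' a, L (i a) a + (∑' a, η k a + ∑' a, η k a) := by
          rw [ENNReal.tsum_add, ENNReal.tsum_add]
      _ ≤ _ := by
          gcongr
          exacts [(hηsum k).le, (hηsum k).le]

/-- The perimeter is countably subadditive. -/
theorem Per_iUnion_le [ProperSpace X] {E : Set X} (hE : MeasurableSet E) (A : ℕ → Set X) :
    Per m E (⋃ i, A i) ≤ ∑' i, Per m E (A i) := by
  refine ENNReal.le_of_forall_pos_le_add fun ε hε hlt => ?_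
  obtain ⟨e, he0, hesum⟩ := ENNReal.exists_pos_sum_of_countable' (ι := ℕ) (ε := ε)
    (by simpa using hε.ne')
  have : ∀ i, ∃ U, IsOpen U ∧ A i ⊆ U ∧ Per m E U < Per m E (A i) + e i := fun i =>
    exists_isOpen_Per_lt (ENNReal.lt_add_right
      (ne_top_of_le_ne_top hlt.ne (ENNReal.le_tsum i)) (he0 i).ne')
  choose U hU hAU hlt' using this
  calc Per m E (⋃ i, A i) ≤ Per m E (⋃ i, U i) := Per_mono E (iUnion_mono hAU)
    _ ≤ ∑' i, Per m E (U i) := Per_iUnion_le_of_isOpen hE hU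
    _ ≤ ∑' i, (Per m E (A i) + e i) := ENNReal.tsum_le_tsum fun i => (hlt' i).le
    _ = ∑' i, Per m E (A i) + ∑' i, e i := ENNReal.tsum_add
    _ ≤ _ := by gcongr

/-- The perimeter as an outer measure. -/
def perOuter [ProperSpace X] (m : Measure X) {E : Set X} (hE : MeasurableSet E) :
    OuterMeasure X where
  measureOf := Per m E
  empty := Per_empty E
  mono := Per_mono E
  iUnion_nat A _ := Per_iUnion_le hE A

theorem Per_union_le [ProperSpace X] {E : Set X} (hE : MeasurableSet E) (A B : Set X) :
    Per m E (A ∪ B) ≤ Per m E A + Per m E B :=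
  measure_union_le (μ := perOuter m hE) A B

theorem perOuter_isMetric [ProperSpace X] {E : Set X} (hE : MeasurableSet E) :
    (perOuter m hE).IsMetric := by
  intro A B hAB
  refine le_antisymm (Per_union_le hE A B) ?_
  change Per m E A + Per m E B ≤ Per m E (A ∪ B)
  refine le_of_forall_gt fun c hc => ?_
  obtain ⟨U, hU, hABU, hlt⟩ := exists_isOpen_Per_lt hc
  obtain ⟨r, hr0, hr⟩ := hAB
  have hr2 : (0 : ℝ≥0∞) < r / 2 := ENNReal.div_pos hr0 (by simp)
  let T : Set X → Set X := fun A => {x | infEDist x A < r / 2}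
  have hTo : ∀ A, IsOpen (T A) := fun A => isOpen_lt continuous_infEDist continuous_const
  have hAT : ∀ A, A ⊆ T A := fun A x hx => by
    change infEDist x A < _
    rwa [infEDist_zero_of_mem hx]
  have hdisj : ∀ x ∈ T A, x ∉ T B := by
    intro x hxA hxB
    obtain ⟨a, ha, hxa⟩ := infEDist_lt_iff.1 hxA
    obtain ⟨b, hb, hxb⟩ := infEDist_lt_iff.1 hxB
    refine (hr a ha b hb).not_gt ?_
    calc edist a b ≤ edist x a + edist x b := edist_triangle_left _ _ _
      _ < r / 2 + r / 2 := ENNReal.add_lt_add hxa hxb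
      _ = r := ENNReal.add_halves r
  have h := sum_Per_le (m := m) E Finset.univ (fun i : Bool => cond i (U ∩ T A) (U ∩ T B)) (Ω := U)
    (N := 1) (by simp [hU.inter (hTo _)]) hU (by simp) (fun x => by
      rw [Nat.cast_one, encard_le_one_iff]
      rintro (_ | _) (_ | _) ⟨-, h1⟩ ⟨-, h2⟩
      exacts [rfl, (hdisj x h2.2 h1.2).elim, (hdisj x h1.2 h2.2).elim, rfl])
  simp only [Fintype.sum_bool, cond_true, cond_false, Nat.cast_one, one_mul] at h
  refine (add_le_add (Per_mono E ?_) (Per_mono E ?_)).trans_lt (h.trans_lt hlt)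
  · exact subset_inter (subset_union_left.trans hABU) (hAT A)
  · exact subset_inter (subset_union_right.trans hABU) (hAT B)

theorem le_perOuter_caratheodory [ProperSpace X] {E : Set X} (hE : MeasurableSet E) :
    ‹MeasurableSpace X› ≤ (perOuter m hE).caratheodory := by
  have h := (perOuter_isMetric (m := m) hE).borel_le_caratheodory
  rwa [← BorelSpace.measurable_eq (α := X)] at h

theorem Per_iUnion_eq_iSup [ProperSpace X] {E : Set X} (hE : MeasurableSet E) {V : ℕ → Set X}
    (hV : Monotone V) (hVm : ∀ n, MeasurableSet (V n)) :
    Per m E (⋃ n, V n) = ⨆ n, Per m E (V n) := by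
  have h1 : ∀ A, MeasurableSet A →
      (perOuter m hE).toMeasure (le_perOuter_caratheodory hE) A = Per m E A := fun A hA =>
    toMeasure_apply _ _ hA
  rw [← h1 _ (MeasurableSet.iUnion hVm), hV.measure_iUnion]
  exact iSup_congr fun n => h1 _ (hVm n)

end Subadditivity

theorem min_measure_le_lintegral_abs_sub [MeasurableSpace X] {m : Measure X} {E A : Set X} (hE : MeasurableSet E) (t : ℝ) :
    min (m (E ∩ A)) (m (A \ E)) ≤
      ∫⁻ x in A, ENNReal.ofReal |E.indicator (fun _ => (1 : ℝ)) x - t| ∂m := by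
  set μ := min (m (E ∩ A)) (m (A \ E))
  have h1 : (1 : ℝ≥0∞) ≤ ENNReal.ofReal |1 - t| + ENNReal.ofReal |t| := by
    rw [← ENNReal.ofReal_add (abs_nonneg _) (abs_nonneg _), ENNReal.one_le_ofReal]
    calc (1 : ℝ) = |1 - t + t| := by simp
      _ ≤ _ := abs_add_le _ _
  rw [← lintegral_inter_add_sdiff _ A hE]
  have h2 : ∫⁻ x in A ∩ E, ENNReal.ofReal |E.indicator (fun _ => (1 : ℝ)) x - t| ∂m =
      ENNReal.ofReal |1 - t| * m (E ∩ A) := by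
    rw [inter_comm, ← setLIntegral_const, ← Measure.restrict_restrict hE]
    exact setLIntegral_congr_fun hE fun x hx => by simp only [indicator_of_mem hx]
  have h3 : ∫⁻ x in A \ E, ENNReal.ofReal |E.indicator (fun _ => (1 : ℝ)) x - t| ∂m =
      ENNReal.ofReal |t| * m (A \ E) := by
    rw [Set.sdiff_eq, inter_comm, ← setLIntegral_const, ← Measure.restrict_restrict hE.compl]
    exact setLIntegral_congr_fun hE.compl fun x hx => by
      simp only [indicator_of_notMem hx, zero_sub, abs_neg]
  rw [h2, h3]
  calc μ = 1 * μ := (one_mul _).symm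
    _ ≤ (ENNReal.ofReal |1 - t| + ENNReal.ofReal |t|) * μ := by gcongr
    _ = ENNReal.ofReal |1 - t| * μ + ENNReal.ofReal |t| * μ := add_mul _ _ _
    _ ≤ _ := by
      gcongr
      exacts [min_le_left _ _, min_le_right _ _]

section Cutoff

/-- The piecewise linear function which is `0` below `r` and `1` above `s`. -/
def ramp (r s t : ℝ) : ℝ := max 0 (min 1 ((t - r) / (s - r)))

theorem ramp_mem (r s t : ℝ) : 0 ≤ ramp r s t ∧ ramp r s t ≤ 1 :=
  ⟨le_max_left _ _, max_le zero_le_one (min_le_left _ _)⟩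

theorem ramp_eq_zero {r s t : ℝ} (h : r < s) (ht : t ≤ r) : ramp r s t = 0 :=
  max_eq_left ((min_le_right _ _).trans
    (div_nonpos_of_nonpos_of_nonneg (by linarith) (by linarith)))

theorem ramp_eq_one {r s t : ℝ} (h : r < s) (ht : s ≤ t) : ramp r s t = 1 := by
  have : 1 ≤ (t - r) / (s - r) := (one_le_div (by linarith)).2 (by linarith)
  rw [ramp, min_eq_left this, max_eq_right zero_le_one]

theorem lipschitzWith_ramp {r s : ℝ} (h : r < s) : LipschitzWith (s - r)⁻¹.toNNReal (ramp r s) := by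
  have : LipschitzWith (s - r)⁻¹.toNNReal fun t => (t - r) / (s - r) := by
    refine LipschitzWith.of_dist_le_mul fun y z => ?_
    rw [Real.coe_toNNReal (s - r)⁻¹ (inv_nonneg.2 (by linarith)), Real.dist_eq, ← sub_div, abs_div,
      abs_of_pos (show 0 < s - r by linarith), div_eq_inv_mul, Real.dist_eq,
      show y - r - (z - r) = y - z by ring]
  exact (this.const_min 1).const_max 0

variable [MetricSpace X]

theorem LipNear.cutoff_mul {f φ : X → ℝ} {A U : Set X} (hA : IsClosed A) (hAU : A ⊆ U)
    (hf : ∀ x ∈ U, LipNear f x) (hφ : ∀ x, LipNear φ x) (h0 : ∀ x ∉ A, φ x = 0) (x : X) :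
    LipNear (fun y => φ y * f y) x := by
  by_cases hx : x ∈ A
  · exact (hφ x).mul (hf x (hAU hx))
  · refine (lipNear_const 0 x).congr ?_
    filter_upwards [hA.isOpen_compl.mem_nhds hx] with y hy
    rw [h0 y hy, zero_mul]

theorem LipschitzWith.ramp_comp {g : X → ℝ} (hg : LipschitzWith 1 g) {r s : ℝ} (h : r < s) :
    LipschitzWith (s - r)⁻¹.toNNReal fun x => ramp r s (g x) := by
  have := (lipschitzWith_ramp h).comp hg
  rwa [mul_one] at this

end Cutoff

section PIspace

theorem exists_finset_net [MetricSpace X] {A : Set X} {r : ℝ} (hr : 0 < r) {N : ℕ}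
    (h : ∀ S : Finset X, ↑S ⊆ A → (S : Set X).Pairwise (fun x y => r ≤ dist x y) → S.card ≤ N) :
    ∃ S : Finset X, ↑S ⊆ A ∧ (S : Set X).Pairwise (fun x y => r ≤ dist x y) ∧
      ∀ x ∈ A, ∃ y ∈ S, dist x y < r := by
  classical
  by_contra! H
  have : ∀ n : ℕ, ∃ S : Finset X, ↑S ⊆ A ∧ (S : Set X).Pairwise (fun x y => r ≤ dist x y) ∧
      n ≤ S.card := by
    intro n
    induction n with
    | zero => exact ⟨∅, by simp, by simp, by simp⟩
    | succ n ih =>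
      obtain ⟨S, hSA, hS, hn⟩ := ih
      obtain ⟨x, hxA, hx⟩ := H S hSA hS
      have hxS : x ∉ S := fun hxS => by
        have := hx x hxS
        rw [dist_self] at this
        linarith
      refine ⟨insert x S, ?_, ?_, ?_⟩
      · rw [Finset.coe_insert]
        exact insert_subset hxA hSA
      · rw [Finset.coe_insert]
        refine hS.insert fun y hy _ => ⟨hx y hy, ?_⟩
        rw [dist_comm]; exact hx y hy
      · rw [Finset.card_insert_of_notMem hxS]; omega
  obtain ⟨S, h1, h2, h3⟩ := this (N + 1)
  have := h S h1 h2
  omega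

variable [MetricSpace X] [MeasurableSpace X] {m : Measure X}

theorem UnifLocDoublingWith.measure_ball_le {C : ℝ → ℝ} (h : UnifLocDoublingWith C m) {R : ℝ}
    (hR : 0 < R) (x : X) (k : ℕ) {r s : ℝ} (hs : s < 2 * R) (hsr : s ≤ 2 ^ k * r) :
    m (ball x s) ≤ ENNReal.ofReal (C R) ^ k * m (ball x r) := by
  induction k generalizing s with
  | zero => simpa using measure_mono (ball_subset_ball (by simpa using hsr))
  | succ k ih =>
    rcases le_or_gt s 0 with hs0 | hs0
    · simp [ball_eq_empty.2 hs0]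
    have h1 := h R hR x (s / 2) (half_pos hs0) (by linarith)
    rw [mul_div_cancel₀ _ two_ne_zero] at h1
    refine h1.trans ?_
    rw [pow_succ', mul_assoc]
    gcongr
    refine ih (by linarith) ?_
    rw [pow_succ'] at hsr
    linarith

theorem UnifLocDoublingWith.measure_ball_ne_zero {C : ℝ → ℝ} (h : UnifLocDoublingWith C m)
    (hm : m ≠ 0) (x : X) {r : ℝ} (hr : 0 < r) : m (ball x r) ≠ 0 := by
  intro h0
  refine hm (Measure.measure_univ_eq_zero.1 ?_)
  rw [← iUnion_ball_nat x]
  refine measure_iUnion_null fun n => ?_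
  obtain ⟨k, hk⟩ := pow_unbounded_of_one_lt ((n : ℝ) / r) one_lt_two
  have := h.measure_ball_le (R := n + 1) (by positivity) x k (r := r) (s := n) (by linarith)
    ((div_le_iff₀ hr).1 hk.le)
  rw [h0, mul_zero] at this
  exact le_antisymm this zero_le

variable [BorelSpace X]

theorem card_mul_le_of_separated {S : Finset X} {x : X} {ρ r : ℝ} {D : ℝ≥0∞}
    (hS : ∀ y ∈ S, dist y x ≤ ρ) (hsep : (S : Set X).Pairwise fun y z => r ≤ dist y z)
    (hD : ∀ y ∈ S, m (ball x (ρ + r)) ≤ D * m (ball y (r / 2)))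
    (h0 : m (ball x (ρ + r)) ≠ 0) (htop : m (ball x (ρ + r)) ≠ ∞) (hr : 0 < r) : S.card ≤ D := by
  have hdisj : (S : Set X).PairwiseDisjoint fun y => ball y (r / 2) := fun y hy z hz hyz =>
    ball_disjoint_ball (by linarith [hsep hy hz hyz])
  have h : S.card * m (ball x (ρ + r)) ≤ D * m (ball x (ρ + r)) := by
    calc S.card * m (ball x (ρ + r)) = ∑ y ∈ S, m (ball x (ρ + r)) := by simp
      _ ≤ ∑ y ∈ S, D * m (ball y (r / 2)) := Finset.sum_le_sum hD
      _ = D * m (⋃ y ∈ S, ball y (r / 2)) := by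
        rw [← Finset.mul_sum, measure_biUnion_finset hdisj fun _ _ => measurableSet_ball]
      _ ≤ _ := by
        gcongr
        refine iUnion₂_subset fun y hy => ball_subset_ball' ?_
        linarith [hS y hy]
  exact (ENNReal.mul_le_mul_iff_left h0 htop).1 h

theorem UnifLocDoublingWith.exists_card_le {C : ℝ → ℝ} (h : UnifLocDoublingWith C m)
    (hm : m ≠ 0) (hb : BoundedlyFinite m) (x : X) (ρ : ℝ) {r : ℝ} (hr : 0 < r) :
    ∃ N : ℕ, ∀ S : Finset X, ↑S ⊆ closedBall x ρ →
      (S : Set X).Pairwise (fun y z => r ≤ dist y z) → S.card ≤ N := by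
  rcases le_or_gt ρ 0 with hρ | hρ
  · refine ⟨1, fun S hS _ => Finset.card_le_one.2 fun a ha b hb => ?_⟩
    have h1 := (hS ha); have h2 := hS hb
    rw [mem_closedBall] at h1 h2
    rw [dist_le_zero.1 (h1.trans hρ), dist_le_zero.1 (h2.trans hρ)]
  obtain ⟨k, hk⟩ := pow_unbounded_of_one_lt ((2 * ρ + r) / (r / 2)) one_lt_two
  have hR : 0 < 2 * ρ + r := by positivity
  set D := ENNReal.ofReal (C (2 * ρ + r)) ^ k
  obtain ⟨N, hN⟩ := ENNReal.exists_nat_gt (show D ≠ ∞ from ENNReal.pow_ne_top (by simp))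
  refine ⟨N, fun S hS hsep => ?_⟩
  have := card_mul_le_of_separated (m := m) (D := D) (fun y hy => mem_closedBall.1 (hS hy)) hsep
    (fun y hy => ?_) (h.measure_ball_ne_zero hm x (by positivity)) (hb _ isBounded_ball).ne hr
  · exact_mod_cast this.trans hN.le
  · refine le_trans (measure_mono (ball_subset_ball' (ε₂ := 2 * ρ + r) ?_))
      (h.measure_ball_le hR y k (by linarith) ((div_le_iff₀ (by positivity)).1 hk.le))
    have := mem_closedBall.1 (hS hy)
    rw [dist_comm] at this
    linarith

theorem UnifLocDoublingWith.properSpace [CompleteSpace X] {C : ℝ → ℝ}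
    (h : UnifLocDoublingWith C m) (hm : m ≠ 0) (hb : BoundedlyFinite m) : ProperSpace X := by
  refine ⟨fun x ρ => isCompact_iff_totallyBounded_isComplete.2
    ⟨Metric.totallyBounded_iff.2 fun ε hε => ?_, isClosed_closedBall.isComplete⟩⟩
  obtain ⟨N, hN⟩ := h.exists_card_le hm hb x ρ hε
  obtain ⟨S, -, -, hS⟩ := exists_finset_net hε hN
  refine ⟨S, S.finite_toSet, fun y hy => ?_⟩
  obtain ⟨z, hz, hd⟩ := hS y hy
  exact mem_biUnion hz hd

/-- The relative isoperimetric inequality. -/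
theorem WeakPoincareWith.min_measure_le {lam : ℝ} {C : ℝ → ℝ} (h : WeakPoincareWith lam C m)
    (hlam : 1 ≤ lam) (hC : 0 < C 1) [ProperSpace X] (h0 : ∀ x r, 0 < r → m (ball x r) ≠ 0)
    (htop : ∀ x r, m (ball x r) ≠ ∞) {E : Set X} (hE : MeasurableSet E) {x : X} {r : ℝ} (hr : 0 < r)
    (hr1 : r < 1) : min (m (E ∩ ball x r)) (m (ball x r \ E)) ≤
      ENNReal.ofReal (C 1 * r) * Per m E (ball x (2 * lam * r)) := by
  have hlr : r ≤ lam * r := le_mul_of_one_le_left hr.le hlam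
  have hK0 : ENNReal.ofReal (C 1 * r) ≠ 0 := by
    rw [Ne, ENNReal.ofReal_eq_zero, not_le]; positivity
  have key : ∀ c, Per m E (ball x (2 * lam * r)) < c →
      min (m (E ∩ ball x r)) (m (ball x r \ E)) ≤ ENNReal.ofReal (C 1 * r) * c := by
    intro c hc
    obtain ⟨f, hf, -, hflim, hflt⟩ := exists_approx hc
    let η : X → ℝ := fun y => 1 - ramp (lam * r) (3 / 2 * (lam * r)) (dist y x)
    have hlt : lam * r < 3 / 2 * (lam * r) := by linarith
    have hη1 : ∀ y ∈ ball x (lam * r), η y = 1 := fun y hy => by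
      simp only [η, ramp_eq_zero hlt (mem_ball.1 hy).le, sub_zero]
    have hη : ∀ y, LipNear η y := fun y =>
      LipNear.of_abs_le (((LipschitzWith.dist_left x).ramp_comp hlt).lipNear y) fun y z => by
        rw [abs_sub_comm]; exact le_of_eq (congrArg _ (by simp only [η]; ring))
    have hg : ∀ n y, LipNear (fun y => η y * f n y) y := fun n =>
      LipNear.cutoff_mul (isClosed_closedBall (x := x) (ε := 3 / 2 * (lam * r)))
        (closedBall_subset_ball (by linarith)) (hf n) hη fun y hy => by
          rw [mem_closedBall, not_le] at hy
          simp only [η, ramp_eq_one hlt hy.le, sub_self]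
    have hbound : ∀ n, min (m (E ∩ ball x r)) (m (ball x r \ E)) ≤
        ENNReal.ofReal (C 1 * r) * c + ∫⁻ y in closedBall x r,
          ENNReal.ofReal |f n y - E.indicator (fun _ => 1) y| ∂m := by
      intro n
      have hP := h (fun y => η y * f n y) ((locLipOn_iff isOpen_univ).2 fun y _ => hg n y) 1
        one_pos x r hr hr1
      set t := ⨍ z in ball x r, η z * f n z ∂m
      have hP2 : ∫⁻ y in ball x r, ENNReal.ofReal |f n y - t| ∂m ≤
          ENNReal.ofReal (C 1 * r) * c := by
        rw [ENNReal.div_le_iff (h0 x r hr) (htop x r)] at hP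
        calc ∫⁻ y in ball x r, ENNReal.ofReal |f n y - t| ∂m
            = ∫⁻ y in ball x r, ENNReal.ofReal |η y * f n y - t| ∂m :=
              setLIntegral_congr_fun measurableSet_ball fun y hy => by
                simp only [hη1 y (ball_subset_ball hlr hy), one_mul]
          _ ≤ _ := hP
          _ ≤ ENNReal.ofReal (C 1 * r) * ((∫⁻ y in ball x (lam * r),
              mSlope (fun y => η y * f n y) y ∂m) / m (ball x (lam * r))) *
                m (ball x (lam * r)) := by
              gcongr
          _ = ENNReal.ofReal (C 1 * r) *
              ∫⁻ y in ball x (lam * r), mSlope (fun y => η y * f n y) y ∂m := by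
              rw [mul_assoc, ENNReal.div_mul_cancel (h0 x _ (hr.trans_le hlr)) (htop x _)]
          _ = ENNReal.ofReal (C 1 * r) * ∫⁻ y in ball x (lam * r), mSlope (f n) y ∂m := by
              congr 1
              refine setLIntegral_congr_fun measurableSet_ball fun y hy => mSlope_congr ?_
              filter_upwards [isOpen_ball.mem_nhds hy] with z hz
              rw [hη1 z hz, one_mul]
          _ ≤ _ := by
              gcongr
              refine (lintegral_mono_set (ball_subset_ball ?_)).trans (hflt n).le
              linarith
      refine (min_measure_le_lintegral_abs_sub hE t).trans ?_
      have hsub : ball x r ⊆ ball x (2 * lam * r) := ball_subset_ball (by linarith)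
      calc ∫⁻ y in ball x r, ENNReal.ofReal |E.indicator (fun _ => (1 : ℝ)) y - t| ∂m
          ≤ ∫⁻ y in ball x r, (ENNReal.ofReal |f n y - t| +
              ENNReal.ofReal |f n y - E.indicator (fun _ => (1 : ℝ)) y|) ∂m := by
            refine lintegral_mono fun y => ?_
            simp only
            rw [← ENNReal.ofReal_add (abs_nonneg _) (abs_nonneg _),
              abs_sub_comm (f n y) (E.indicator _ y), add_comm]
            exact ENNReal.ofReal_le_ofReal (abs_sub_le _ _ _)
        _ = ∫⁻ y in ball x r, ENNReal.ofReal |f n y - t| ∂m + ∫⁻ y in ball x r,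
              ENNReal.ofReal |f n y - E.indicator (fun _ => (1 : ℝ)) y| ∂m :=
            lintegral_add_right' _
              (aemeasurable_ofReal_abs_sub_indicator hE isOpen_ball (hf n) hsub)
        _ ≤ _ := add_le_add hP2 (lintegral_mono_set ball_subset_closedBall)
    have hlim := hflim (closedBall x r) (closedBall_subset_ball (by linarith))
      (isCompact_closedBall x r)
    have := hlim.const_add (ENNReal.ofReal (C 1 * r) * c)
    rw [add_zero] at this
    exact ge_of_tendsto' this hbound
  rcases eq_or_ne (Per m E (ball x (2 * lam * r))) ∞ with hP | hP
  · rw [hP, ENNReal.mul_top hK0]; exact le_top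
  · have hlim := ENNReal.Tendsto.const_mul (a := ENNReal.ofReal (C 1 * r))
      (ENNReal.tendsto_inv_nat_nhds_zero.const_add (Per m E (ball x (2 * lam * r))))
      (Or.inr ofReal_ne_top)
    rw [add_zero] at hlim
    exact ge_of_tendsto' hlim fun n => key _ (ENNReal.lt_add_right hP (by simp))

/-- The quantitative consequences of the PI condition at small scales. -/
structure PIBound (m : Measure X) (C : NNReal) (lam : ℝ) : Prop where
  one_le_lam : 1 ≤ lam
  one_le_const : 1 ≤ C
  ball_ne_zero : ∀ x r, 0 < r → m (ball x r) ≠ 0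
  ball_ne_top : ∀ x r, m (ball x r) ≠ ∞
  doubling : ∀ x (k : ℕ) (r s : ℝ), s < 2 → s ≤ 2 ^ k * r → m (ball x s) ≤ C ^ k * m (ball x r)
  isoperimetric : ∀ E, MeasurableSet E → ∀ x r, 0 < r → r < 1 →
    min (m (E ∩ ball x r)) (m (ball x r \ E)) ≤
      C * ENNReal.ofReal r * Per m E (ball x (2 * lam * r))

theorem IsPIspace.properSpace [CompleteSpace X] (h : IsPIspace m) (hb : BoundedlyFinite m)
    (hm : m ≠ 0) : ProperSpace X := by
  obtain ⟨⟨_, _, hD⟩, -⟩ := h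
  exact hD.properSpace hm hb

theorem IsPIspace.exists_bound [ProperSpace X] (h : IsPIspace m) (hb : BoundedlyFinite m)
    (hm : m ≠ 0) : ∃ C lam, PIBound m C lam := by
  obtain ⟨⟨D, -, hD⟩, lam, hlam, P, hP0, hP⟩ := h
  have h0 : ∀ x r, 0 < r → m (ball x r) ≠ 0 := fun x r hr => hD.measure_ball_ne_zero hm x hr
  have htop : ∀ x r, m (ball x r) ≠ ∞ := fun x r => (hb _ isBounded_ball).ne
  have h1 : ENNReal.ofReal (D 1) ≤ (max 1 (max (D 1).toNNReal (P 1).toNNReal) : NNReal) :=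
    ENNReal.coe_le_coe.2 ((le_max_left _ _).trans (le_max_right _ _))
  have h2 : ENNReal.ofReal (P 1) ≤ (max 1 (max (D 1).toNNReal (P 1).toNNReal) : NNReal) :=
    ENNReal.coe_le_coe.2 ((le_max_right _ _).trans (le_max_right _ _))
  refine ⟨max 1 (max (D 1).toNNReal (P 1).toNNReal), lam, hlam, le_max_left _ _, h0, htop,
    fun x k r s hs hsr => ?_, fun E hE x r hr hr1 => ?_⟩
  · refine (hD.measure_ball_le one_pos x k (by linarith) hsr).trans ?_
    gcongr
  · refine (hP.min_measure_le hlam (hP0 1 one_pos) h0 htop hE hr hr1).trans ?_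
    rw [ENNReal.ofReal_mul (hP0 1 one_pos).le]
    gcongr

end PIspace

section Boxing

variable [MetricSpace X] [MeasurableSpace X] {m : Measure X} {C : NNReal} {lam : ℝ}

theorem PIBound.isLocallyFiniteMeasure (h : PIBound m C lam) : IsLocallyFiniteMeasure m :=
  ⟨fun x => ⟨ball x 1, ball_mem_nhds x one_pos, (h.ball_ne_top x 1).lt_top⟩⟩

theorem PIBound.isUnifLocDoublingMeasure (h : PIBound m C lam) : IsUnifLocDoublingMeasure m := by
  refine ⟨C ^ 2, ?_⟩
  filter_upwards [Ioo_mem_nhdsGT (show (0 : ℝ) < 1 / 2 by norm_num)] with r hr x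
  calc m (closedBall x (2 * r)) ≤ m (ball x (2 * r + r)) :=
        measure_mono (closedBall_subset_ball (by linarith [hr.1]))
    _ ≤ C ^ 2 * m (ball x r) := h.doubling x 2 r _ (by linarith [hr.2]) (by linarith [hr.1])
    _ ≤ _ := by
      push_cast
      gcongr
      exact ball_subset_closedBall

theorem PIBound.exists_scale (h : PIBound m C lam) {E : Set X} (hE : MeasurableSet E) {y : X}
    {s : ℝ} (hs : 0 < s) (hs1 : s < 1)
    (hd : ∀ᶠ r in 𝓝[>] (0 : ℝ), m (ball y r) ≤ 2 * C * m (E ∩ ball y r))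
    (hlow : 2 * C * m (E ∩ ball y s) < m (ball y s)) :
    ∃ t, 0 < t ∧ t ≤ s ∧
      m (ball y t) ≤ 2 * C ^ 3 * ENNReal.ofReal t * Per m E (ball y (2 * lam * t)) := by
  classical
  have hpos : ∀ k : ℕ, 0 < s / 2 ^ k := fun k => by positivity
  have hex : ∃ k : ℕ, m (ball y (s / 2 ^ k)) ≤ 2 * C * m (E ∩ ball y (s / 2 ^ k)) := by
    have : Tendsto (fun k : ℕ => s / 2 ^ k) atTop (𝓝[>] 0) := by
      refine tendsto_nhdsWithin_iff.2 ⟨?_, Eventually.of_forall hpos⟩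
      have := (tendsto_pow_atTop_nhds_zero_of_lt_one (r := (1 / 2 : ℝ)) (by norm_num)
        (by norm_num)).const_mul s
      simpa [div_eq_mul_inv] using this
    exact (this.eventually hd).exists
  obtain ⟨j, hj⟩ : ∃ j, Nat.find hex = j + 1 := by
    refine Nat.exists_eq_succ_of_ne_zero fun h0 => ?_
    have := Nat.find_spec hex
    rw [h0, pow_zero, div_one] at this
    exact this.not_gt hlow
  have h1 := Nat.find_spec hex
  have h2 := Nat.find_min hex (m := j) (by omega)
  rw [hj] at h1
  set t := s / 2 ^ j with ht
  have ht0 : 0 < t := hpos j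
  have hts : t ≤ s := div_le_self hs.le (one_le_pow₀ (by norm_num))
  have ht2 : s / 2 ^ (j + 1) = t / 2 := by rw [ht, pow_succ]; field_simp
  rw [ht2] at h1
  push Not at h2
  refine ⟨t, ht0, hts, ?_⟩
  have hC : (1 : ℝ≥0∞) ≤ C := by exact_mod_cast h.one_le_const
  have hE1 : m (ball y t) ≤ 2 * C ^ 2 * m (E ∩ ball y t) := by
    calc m (ball y t) ≤ C ^ 1 * m (ball y (t / 2)) :=
          h.doubling y 1 _ _ (by linarith) (by linarith)
      _ ≤ C ^ 1 * (2 * C * m (E ∩ ball y (t / 2))) := by gcongr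
      _ ≤ C ^ 1 * (2 * C * m (E ∩ ball y t)) := by
        gcongr
        linarith
      _ = _ := by ring
  have hE2 : m (ball y t) ≤ 2 * C ^ 2 * m (ball y t \ E) := by
    have h3 : m (ball y t) = m (E ∩ ball y t) + m (ball y t \ E) := by
      rw [inter_comm, measure_inter_add_sdiff _ hE]
    have h4 : m (E ∩ ball y t) ≤ m (ball y t \ E) := by
      have h5 : m (E ∩ ball y t) + m (E ∩ ball y t) ≤ m (E ∩ ball y t) + m (ball y t \ E) := by
        rw [← h3, ← two_mul]
        refine le_trans ?_ h2.le
        gcongr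
        exact le_mul_of_one_le_right zero_le hC
      refine (ENNReal.add_le_add_iff_left ?_).1 h5
      exact ((measure_mono inter_subset_right).trans_lt (h.ball_ne_top y t).lt_top).ne
    calc m (ball y t) ≤ 2 * m (ball y t \ E) := by rw [h3, two_mul]; gcongr
      _ ≤ _ := by
        gcongr
        exact le_mul_of_one_le_right zero_le (one_le_pow₀ hC)
  calc m (ball y t) ≤ 2 * C ^ 2 * min (m (E ∩ ball y t)) (m (ball y t \ E)) := by
        rcases le_total (m (E ∩ ball y t)) (m (ball y t \ E)) with h' | h'
        · rwa [min_eq_left h']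
        · rwa [min_eq_right h']
    _ ≤ 2 * C ^ 2 * (C * ENNReal.ofReal t * Per m E (ball y (2 * lam * t))) := by
      gcongr
      exact h.isoperimetric E hE y t ht0 (by linarith)
    _ = _ := by ring

variable [BorelSpace X]

theorem exists_vitali_cover [SecondCountableTopology X] {E Ω A : Set X} (hΩ : IsOpen Ω)
    {s : X → ℝ} {s₀ : ℝ} (hlam : 1 ≤ lam) {D : ℝ≥0∞} (hs : ∀ y ∈ A, 0 < s y ∧ s y ≤ s₀)
    (hsub : ∀ y ∈ A, ball y (2 * lam * s y) ⊆ Ω)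
    (hD : ∀ y ∈ A, m (ball y (s y)) ≤
      D * ENNReal.ofReal (s y) * Per m E (ball y (2 * lam * s y))) :
    ∃ u ⊆ A, u.Countable ∧ A ⊆ ⋃ y ∈ u, ball y (11 * lam * s y) ∧
      ∑' y : u, m (ball (y : X) (s y)) / ENNReal.ofReal (s y) ≤ D * Per m E Ω := by
  classical
  have hpos : ∀ y ∈ A, 0 < lam * s y := fun y hy => mul_pos (by linarith) (hs y hy).1
  obtain ⟨u, huA, hdisj, hcov⟩ := Vitali.exists_disjoint_subfamily_covering_enlargement_closedBall
    A (fun y => y) (fun y => 2 * lam * s y) (2 * lam * s₀)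
    (fun y hy => mul_le_mul_of_nonneg_left (hs y hy).2 (by linarith)) 5 (by norm_num)
  have hdisj' : u.PairwiseDisjoint fun y => ball y (2 * lam * s y) :=
    hdisj.mono fun y => ball_subset_closedBall
  refine ⟨u, huA, ?_, ?_, ?_⟩
  · refine hdisj'.countable_of_isOpen (fun _ _ => isOpen_ball) fun y hy => ?_
    exact nonempty_ball.2 (by linarith [hpos y (huA hy)])
  · intro y hy
    obtain ⟨b, hb, hyb⟩ := hcov y hy
    have hy' := hyb (mem_closedBall_self (by linarith [hpos y hy]))
    refine mem_biUnion hb (closedBall_subset_ball ?_ hy')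
    linarith [hpos b (huA hb)]
  · refine ENNReal.summable.tsum_le_of_sum_le fun S => ?_
    calc ∑ y ∈ S, m (ball (y : X) (s y)) / ENNReal.ofReal (s y)
        ≤ ∑ y ∈ S, D * Per m E (ball (y : X) (2 * lam * s y)) := by
          refine Finset.sum_le_sum fun y _ => ?_
          refine ENNReal.div_le_of_le_mul ?_
          refine (hD y (huA y.2)).trans (le_of_eq ?_)
          ring
      _ = D * ∑ y ∈ S, Per m E (ball (y : X) (2 * lam * s y)) := by rw [Finset.mul_sum]
      _ ≤ D * ((1 : ℕ) * Per m E Ω) := by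
        gcongr
        refine sum_Per_le E S _ (fun _ _ => isOpen_ball) hΩ (fun y _ => hsub y (huA y.2)) ?_
        intro x
        rw [Nat.cast_one, Set.encard_le_one_iff]
        rintro a b ⟨-, ha⟩ ⟨-, hb⟩
        by_contra hab
        exact disjoint_left.1 (hdisj' a.2 b.2 fun h => hab (Subtype.ext h)) ha hb
      _ = _ := by rw [Nat.cast_one, one_mul]

theorem PIBound.ae_density [SecondCountableTopology X] (h : PIBound m C lam) {E : Set X}
    (hE : MeasurableSet E) :
    ∀ᵐ y ∂m, y ∈ E → ∀ᶠ r in 𝓝[>] (0 : ℝ), m (ball y r) ≤ 2 * C * m (E ∩ ball y r) := by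
  have := h.isLocallyFiniteMeasure
  have := h.isUnifLocDoublingMeasure
  have key := IsUnifLocDoublingMeasure.ae_tendsto_measure_inter_div m E 1
  rw [ae_restrict_iff' hE] at key
  filter_upwards [key] with y hy hyE
  have hhalf : Tendsto (fun r : ℝ => r / 2) (𝓝[>] 0) (𝓝[>] 0) := by
    refine tendsto_nhdsWithin_iff.2 ⟨?_, ?_⟩
    · have : Tendsto (fun r : ℝ => r / 2) (𝓝 0) (𝓝 (0 / 2)) := tendsto_id.div_const 2
      rw [zero_div] at this
      exact this.mono_left nhdsWithin_le_nhds
    · filter_upwards [self_mem_nhdsWithin] with r hr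
      exact half_pos (mem_Ioi.1 hr)
  have h1 := hy hyE (fun _ => y) (fun r : ℝ => r / 2) hhalf (by
    filter_upwards [self_mem_nhdsWithin] with r hr
    exact mem_closedBall_self (by rw [one_mul]; exact (half_pos (mem_Ioi.1 hr)).le))
  filter_upwards [h1.eventually (lt_mem_nhds (show (2 : ℝ≥0∞)⁻¹ < 1 by simp)),
    Ioo_mem_nhdsGT (show (0 : ℝ) < 1 by norm_num)] with r hr hr1
  have h2 : m (closedBall y (r / 2)) ≤ 2 * m (E ∩ closedBall y (r / 2)) := by
    have := ENNReal.mul_le_of_le_div hr.le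
    rwa [mul_comm, ← div_eq_mul_inv, ENNReal.div_le_iff_le_mul (by simp) (by simp),
      mul_comm] at this
  calc m (ball y r) ≤ C ^ 1 * m (ball y (r / 2)) :=
        h.doubling y 1 _ _ (by linarith [hr1.2]) (by linarith)
    _ ≤ C ^ 1 * m (closedBall y (r / 2)) := by gcongr; exact ball_subset_closedBall
    _ ≤ C ^ 1 * (2 * m (E ∩ closedBall y (r / 2))) := by gcongr
    _ ≤ C ^ 1 * (2 * m (E ∩ ball y r)) := by
      gcongr
      exact closedBall_subset_ball (by linarith [hr1.1])
    _ = _ := by ring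

theorem PIBound.measure_inter_ball_le [SecondCountableTopology X] (h : PIBound m C lam)
    {E : Set X} (hE : MeasurableSet E) {x : X} {r s : ℝ} {δ : ℝ≥0∞} {k l : ℕ}
    (hl : 11 * lam ≤ 2 ^ l) (hs0 : 0 < s) (hs : 11 * lam * s < 2) (hsr : 2 * lam * s ≤ r)
    (hk : 3 * r ≤ 2 ^ k * s) (hr : 3 * r < 2) (hδ : m (E ∩ ball x (2 * r)) ≤ δ * m (ball x (2 * r)))
    (hδk : 2 * C * (δ * C ^ k) < 1) :
    m (E ∩ ball x r) ≤
      2 * C ^ (l + 3) * ENNReal.ofReal s * Per m E (ball x (2 * r)) := by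
  have hlam := h.one_le_lam
  have hls : s ≤ lam * s := le_mul_of_one_le_left hs0.le hlam
  set A := {y | y ∈ E ∩ ball x r ∧
    ∀ᶠ r in 𝓝[>] (0 : ℝ), m (ball y r) ≤ 2 * C * m (E ∩ ball y r)} with hA
  have hmA : m (E ∩ ball x r) ≤ m A := by
    refine measure_mono_ae ?_
    filter_upwards [h.ae_density hE] with y hy hyE
    exact ⟨hyE, hy hyE.1⟩
  have hscale : ∀ y ∈ A, ∃ t, 0 < t ∧ t ≤ s ∧
      m (ball y t) ≤ 2 * C ^ 3 * ENNReal.ofReal t * Per m E (ball y (2 * lam * t)) := by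
    rintro y ⟨⟨-, hyx⟩, hd⟩
    refine h.exists_scale hE hs0 (by linarith) hd ?_
    rw [mem_ball] at hyx
    have h0 := h.ball_ne_zero y s hs0
    have htop := h.ball_ne_top y s
    calc 2 * C * m (E ∩ ball y s) ≤ 2 * C * m (E ∩ ball x (2 * r)) := by
          gcongr
          exact ball_subset_ball' (by linarith)
      _ ≤ 2 * C * (δ * m (ball x (2 * r))) := by gcongr
      _ ≤ 2 * C * (δ * m (ball y (3 * r))) := by
        gcongr
        exact ball_subset_ball' (by rw [dist_comm]; linarith)
      _ ≤ 2 * C * (δ * (C ^ k * m (ball y s))) := by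
        gcongr
        exact h.doubling y k _ _ hr hk
      _ = 2 * C * (δ * C ^ k) * m (ball y s) := by ring
      _ < 1 * m (ball y s) := (ENNReal.mul_lt_mul_iff_left h0 htop).2 hδk
      _ = m (ball y s) := one_mul _
  choose! t ht0 hts ht using hscale
  obtain ⟨u, huA, hu, hcov, hsum⟩ := exists_vitali_cover (Ω := ball x (2 * r)) isOpen_ball hlam
    (fun y hy => ⟨ht0 y hy, hts y hy⟩) (fun y hy => ball_subset_ball' (by
      have h1 := mem_ball.1 hy.1.2
      have h2 := mul_le_mul_of_nonneg_left (hts y hy) (show 0 ≤ 2 * lam by linarith)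
      linarith)) ht
  have := hu.to_subtype
  calc m (E ∩ ball x r) ≤ m (⋃ y ∈ u, ball y (11 * lam * t y)) := hmA.trans (measure_mono hcov)
    _ ≤ ∑' y : u, m (ball (y : X) (11 * lam * t y)) := measure_biUnion_le m hu _
    _ ≤ ∑' y : u, C ^ l * ENNReal.ofReal s * (m (ball (y : X) (t y)) / ENNReal.ofReal (t y)) := by
      refine ENNReal.tsum_le_tsum fun y => ?_
      have hy0 := ht0 y (huA y.2)
      have hys := hts y (huA y.2)
      calc m (ball (y : X) (11 * lam * t y)) ≤ C ^ l * m (ball (y : X) (t y)) := by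
            refine h.doubling y l _ _ ?_ (mul_le_mul_of_nonneg_right hl hy0.le)
            exact (mul_le_mul_of_nonneg_left hys (by linarith)).trans_lt hs
        _ = C ^ l * (ENNReal.ofReal (t y) * (m (ball (y : X) (t y)) / ENNReal.ofReal (t y))) := by
          rw [ENNReal.mul_div_cancel (by simpa using hy0) (by simp)]
        _ ≤ C ^ l * (ENNReal.ofReal s * (m (ball (y : X) (t y)) / ENNReal.ofReal (t y))) := by
          gcongr
        _ = _ := by ring
    _ ≤ C ^ l * ENNReal.ofReal s * (2 * C ^ 3 * Per m E (ball x (2 * r))) := by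
      rw [ENNReal.tsum_mul_left]
      gcongr
    _ = _ := by ring

end Boxing

section ZeroDensity

theorem IsCompact.exists_finset_net [MetricSpace X] {K : Set X} (hK : IsCompact K) {r : ℝ}
    (hr : 0 < r) :
    ∃ S : Finset X, ↑S ⊆ K ∧ (S : Set X).Pairwise (fun x y => r ≤ dist x y) ∧
      ∀ x ∈ K, ∃ y ∈ S, dist x y < r := by
  obtain ⟨t, -, ht, hcov⟩ := hK.finite_cover_balls (half_pos hr)
  refine _root_.exists_finset_net hr (N := ht.toFinset.card) fun S hSK hS => ?_
  have : ∀ x ∈ S, ∃ c ∈ ht.toFinset, dist x c < r / 2 := fun x hx => by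
    simpa using hcov (hSK hx)
  choose! c hc hxc using this
  refine Finset.card_le_card_of_injOn c hc fun x hx y hy hxy => ?_
  by_contra hne
  have h1 := hS hx hy hne
  have h2 := hxc x hx
  have h3 := hxc y hy
  rw [← hxy] at h3
  linarith [dist_triangle_right x y (c x)]

variable [MetricSpace X] [MeasurableSpace X] {m : Measure X} {C : NNReal} {lam : ℝ}

theorem PIBound.exists_scale_const (h : PIBound m C lam) (c : NNReal) :
    ∃ η : ℝ, 0 < η ∧ 2 * lam * η ≤ 1 ∧ c * ENNReal.ofReal (4 * η) ≤ 4⁻¹ := by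
  have hlam := h.one_le_lam
  have hpos : 0 < 16 * (c : ℝ) + 2 * lam := by have := c.2; positivity
  refine ⟨(16 * c + 2 * lam)⁻¹, inv_pos.2 hpos, ?_, ?_⟩
  · rw [← div_eq_mul_inv, div_le_one hpos]
    linarith [c.2]
  · rw [← ENNReal.ofReal_coe_nnreal, ← ENNReal.ofReal_mul (by positivity : (0 : ℝ) ≤ c),
      ← ENNReal.ofReal_ofNat, ← ENNReal.ofReal_inv_of_pos (by norm_num)]
    refine ENNReal.ofReal_le_ofReal ?_
    rw [← mul_assoc, ← div_eq_mul_inv, div_le_iff₀ hpos]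
    norm_num
    linarith

variable [BorelSpace X]

theorem PIBound.measure_inter_thickening_le [SecondCountableTopology X] (h : PIBound m C lam)
    {E K Ω : Set X} (hE : MeasurableSet E) (hK : IsCompact K) (hne : K.Nonempty) {r η : ℝ}
    {δ : ℝ≥0∞} {k l N : ℕ} (hl : 11 * lam ≤ 2 ^ l) (hN : C ^ 6 ≤ N) (hr0 : 0 < r)
    (hr : r < 1 / 20) (hη0 : 0 < η) (hη : 2 * lam * η ≤ 1) (hk : 3 ≤ 2 ^ k * η)
    (hδk : 2 * C * (δ * C ^ k) < 1) (hδ : ∀ x ∈ K, m (E ∩ ball x (8 * r)) ≤ δ * m (ball x (8 * r)))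
    (hΩ : IsOpen Ω) (hKΩ : ∀ x ∈ K, ball x (8 * r) ⊆ Ω) :
    m (E ∩ {x | infDist x K ≤ 2 * r}) ≤
      N * (2 * C ^ (l + 3) * ENNReal.ofReal (4 * η)) * ENNReal.ofReal r * Per m E Ω := by
  classical
  have hlam := h.one_le_lam
  obtain ⟨S, hSK, hS, hnet⟩ := hK.exists_finset_net hr0
  have h8 : 2 * (4 * r) = 8 * r := by ring
  calc m (E ∩ {x | infDist x K ≤ 2 * r}) ≤ m (⋃ z ∈ S, E ∩ ball z (4 * r)) := by
        refine measure_mono fun x hx => ?_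
        obtain ⟨y, hy, hxy⟩ := hK.exists_infDist_eq_dist hne x
        obtain ⟨z, hz, hyz⟩ := hnet y hy
        have hx2 : infDist x K ≤ 2 * r := hx.2
        refine mem_biUnion hz ⟨hx.1, mem_ball.2 ?_⟩
        linarith [dist_triangle x y z]
    _ ≤ ∑ z ∈ S, m (E ∩ ball z (4 * r)) := measure_biUnion_finset_le _ _
    _ ≤ ∑ z ∈ S, 2 * C ^ (l + 3) * ENNReal.ofReal (4 * η * r) * Per m E (ball z (8 * r)) := by
      refine Finset.sum_le_sum fun z hz => ?_
      have := h.measure_inter_ball_le (x := z) (r := 4 * r) (s := 4 * η * r) (k := k) (δ := δ) hE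
        hl (by positivity) (by nlinarith) (by nlinarith) (by nlinarith) (by linarith)
        (by rw [h8]; exact hδ z (hSK hz)) hδk
      rwa [h8] at this
    _ = 2 * C ^ (l + 3) * ENNReal.ofReal (4 * η * r) * ∑ z ∈ S, Per m E (ball z (8 * r)) := by
      rw [Finset.mul_sum]
    _ ≤ 2 * C ^ (l + 3) * ENNReal.ofReal (4 * η * r) * (N * Per m E Ω) := by
      gcongr
      refine sum_Per_le E S _ (fun _ _ => isOpen_ball) hΩ (fun z hz => hKΩ z (hSK hz)) fun x => ?_
      have hfil : (S : Set X) ∩ {z | x ∈ ball z (8 * r)} =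
          (S.filter fun z => x ∈ ball z (8 * r) : Finset X) := by
        ext; simp
      rw [hfil, Set.encard_coe_eq_coe_finsetCard, Nat.cast_le]
      have := card_mul_le_of_separated (m := m) (S := S.filter fun z => x ∈ ball z (8 * r))
        (x := x) (ρ := 8 * r) (r := r) (D := C ^ 6)
        (fun y hy => by
          have := mem_ball'.1 (Finset.mem_filter.1 hy).2
          exact this.le)
        (hS.mono (Finset.coe_subset.2 (Finset.filter_subset _ _))) (fun y hy => ?_) (h.ball_ne_zero _ _ (by linarith))
        (h.ball_ne_top _ _) hr0
      · exact_mod_cast this.trans (by exact_mod_cast hN : (C : ℝ≥0∞) ^ 6 ≤ (N : ℝ≥0∞))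
      · have hy' := mem_ball.1 (Finset.mem_filter.1 hy).2
        calc m (ball x (8 * r + r)) ≤ m (ball y (17 * r)) :=
              measure_mono (ball_subset_ball' (by linarith))
          _ ≤ C ^ 6 * m (ball y (r / 2)) := h.doubling y 6 _ _ (by linarith) (by linarith)
    _ = _ := by
      rw [ENNReal.ofReal_mul (by positivity)]
      ring

/-- There is a density threshold below which the perimeter of a set does not charge compact
sets. -/
theorem PIBound.exists_density_threshold [ProperSpace X] (h : PIBound m C lam) :
    ∃ δ : NNReal, 0 < δ ∧ ∀ E K : Set X, MeasurableSet E → IsCompact K → Per m E K ≠ ∞ →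
      (∃ ρ > (0 : ℝ), ∀ x ∈ K, ∀ r, 0 < r → r < ρ → m (E ∩ ball x r) ≤ δ * m (ball x r)) →
      Per m E K = 0 := by
  have := h.isLocallyFiniteMeasure
  have hlam := h.one_le_lam
  obtain ⟨l, hl⟩ := pow_unbounded_of_one_lt (11 * lam) (one_lt_two : (1 : ℝ) < 2)
  obtain ⟨N, hN⟩ := exists_nat_ge (C ^ 6)
  obtain ⟨η, hη0, hη, hηc⟩ := h.exists_scale_const (N * (2 * C ^ (l + 3)))
  obtain ⟨k, hk⟩ := pow_unbounded_of_one_lt (3 / η) (one_lt_two : (1 : ℝ) < 2)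
  have hC0 : 0 < C := one_pos.trans_le h.one_le_const
  have hδk : 2 * (C : ℝ≥0∞) * (((4 * C ^ (k + 1))⁻¹ : NNReal) * C ^ k) < 1 := by
    have : 2 * C * ((4 * C ^ (k + 1))⁻¹ * C ^ k) < 1 := by
      have : 2 * C * ((4 * C ^ (k + 1))⁻¹ * C ^ k) = 2⁻¹ := by
        rw [pow_succ]
        field_simp
        norm_num
      rw [this]
      exact inv_lt_one_of_one_lt₀ one_lt_two
    exact_mod_cast this
  set δ : NNReal := (4 * C ^ (k + 1))⁻¹
  have hδ0 : 0 < δ := by positivity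
  refine ⟨δ, hδ0, fun E K hE hK hfin ⟨ρ, hρ, hdens⟩ => ?_⟩
  rcases K.eq_empty_or_nonempty with rfl | hne
  · exact Per_empty E
  by_contra hP
  obtain ⟨U, hU, hKU, hUP⟩ := exists_isOpen_Per_lt (show Per m E K < 2 * Per m E K by
    rw [two_mul]
    exact ENNReal.lt_add_right hfin hP)
  have hUfin : Per m E U ≠ ∞ := hUP.ne_top
  obtain ⟨θ, hθ, hθU⟩ := hK.exists_thickening_subset_open hU hKU
  set R := min (1 / 20) (min (ρ / 10) (θ / 10)) with hR
  have hR0 : 0 < R := by positivity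
  have hR1 : R ≤ 1 / 20 := min_le_left _ _
  have hR2 : R ≤ ρ / 10 := (min_le_right _ _).trans (min_le_left _ _)
  have hR3 : R ≤ θ / 10 := (min_le_right _ _).trans (min_le_right _ _)
  set r : ℕ → ℝ := fun n => R / (n + 2) with hr
  have hr0 : ∀ n, 0 < r n := fun n => by positivity
  have hrR : ∀ n, r n < R := fun n => div_lt_self hR0 (by have := n.cast_nonneg (α := ℝ); linarith)
  have hrlim : Tendsto r atTop (𝓝 0) :=
    tendsto_const_nhds.div_atTop (tendsto_atTop_add_const_right _ _ tendsto_natCast_atTop_atTop)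
  have hsub : ∀ n, {x | infDist x K ≤ 2 * r n} ⊆ U := fun n x hx => by
    refine hθU ?_
    rw [thickening_eq_biUnion_ball, mem_iUnion₂]
    obtain ⟨y, hy, hxy⟩ := hK.exists_infDist_eq_dist hne x
    have hx2 : infDist x K ≤ 2 * r n := hx
    exact ⟨y, hy, mem_ball.2 (by linarith [hrR n])⟩
  have hmeas : ∀ n, m (E ∩ {x | infDist x K ≤ 2 * r n}) ≤
      4⁻¹ * ENNReal.ofReal (r n) * Per m E U := fun n => by
    refine (h.measure_inter_thickening_le hE hK hne hl.le hN (hr0 n) (by linarith [hrR n]) hη0 hη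
      (by rw [div_lt_iff₀ hη0] at hk; exact hk.le) hδk
      (fun x hx => hdens x hx _ (by linarith [hr0 n]) (by linarith [hrR n])) hU
      fun x hx => ?_).trans ?_
    · refine (ball_subset_thickening hx _).trans ((thickening_mono ?_ _).trans hθU)
      linarith [hrR n]
    · gcongr
      refine le_trans (le_of_eq ?_) hηc
      push_cast
      ring
  refine not_forall_cutoff_energy_lt (V := fun n => {x | infDist x K < r n})
    (Q := fun n => {x | infDist x K ≤ 2 * r n})
    (φ := fun n x => ramp (r n) (2 * r n) (infDist x K)) hE hU hUfin
    (fun n => isOpen_lt (continuous_infDist_pt K) continuous_const)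
    (fun n x hx => hsub n (show infDist x K ≤ 2 * r n by
      have hx2 : infDist x K < r n := hx
      linarith [hr0 n]))
    (fun n => ?_) hsub
    (fun n => (lipschitz_infDist_pt K).ramp_comp (by linarith [hr0 n]))
    (fun n x => ramp_mem _ _ _)
    (fun n x hx => ramp_eq_zero (by linarith [hr0 n]) (le_of_lt hx))
    (fun n x hx => ramp_eq_one (by linarith [hr0 n]) ?_) ?_
    (ε := Per m E K / 2) (by simp [hP]) ?_
  · refine isCompact_of_isClosed_isBounded
      (isClosed_le (continuous_infDist_pt K) continuous_const) ?_
    refine (hK.isBounded.cthickening (δ := 2 * r n)).subset fun x hx => ?_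
    rw [hK.cthickening_eq_biUnion_closedBall (by linarith [hr0 n]), mem_iUnion₂]
    obtain ⟨y, hy, hxy⟩ := hK.exists_infDist_eq_dist hne x
    exact ⟨y, hy, mem_closedBall.2 (hxy ▸ hx)⟩
  · exact (not_le.1 hx).le
  · refine tendsto_of_tendsto_of_tendsto_of_le_of_le tendsto_const_nhds ?_ (fun _ => zero_le) hmeas
    have h1 : Tendsto (fun n => ENNReal.ofReal (r n)) atTop (𝓝 0) := by
      simpa using ENNReal.tendsto_ofReal hrlim
    have h2 := ENNReal.Tendsto.mul_const (b := Per m E U)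
      (ENNReal.Tendsto.const_mul (a := (4 : ℝ≥0∞)⁻¹) h1 (.inr (by simp))) (.inr hUfin)
    simpa using h2
  · intro n
    have hKV : Per m E K ≤ Per m E {x | infDist x K < r n} := Per_mono E fun x hx => by
      have : infDist x K = 0 := infDist_zero_of_mem hx
      exact this.trans_lt (hr0 n)
    refine le_trans ?_ hKV
    have hen : ∫⁻ x in E ∩ {x | infDist x K ≤ 2 * r n},
        mSlope (fun x => ramp (r n) (2 * r n) (infDist x K)) x ∂m ≤ Per m E K / 2 := by
      calc _ ≤ ∫⁻ x in E ∩ {x | infDist x K ≤ 2 * r n}, ENNReal.ofReal (r n)⁻¹ ∂m := by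
            refine lintegral_mono fun x => ?_
            refine (((lipschitz_infDist_pt K).ramp_comp
              (show r n < 2 * r n by linarith [hr0 n])).mSlope_le x).trans (le_of_eq ?_)
            rw [show 2 * r n - r n = r n by ring]
            rfl
        _ = ENNReal.ofReal (r n)⁻¹ * m (E ∩ {x | infDist x K ≤ 2 * r n}) := setLIntegral_const _ _
        _ ≤ ENNReal.ofReal (r n)⁻¹ * (4⁻¹ * ENNReal.ofReal (r n) * Per m E U) := by
          gcongr
          exact hmeas n
        _ = ENNReal.ofReal (r n)⁻¹ * ENNReal.ofReal (r n) * (4⁻¹ * Per m E U) := by ring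
        _ = 4⁻¹ * Per m E U := by
          rw [ENNReal.ofReal_inv_of_pos (hr0 n), ENNReal.inv_mul_cancel (by simpa using hr0 n)
            (by simp), one_mul]
        _ ≤ 4⁻¹ * (2 * Per m E K) := by gcongr
        _ = Per m E K / 2 := by
          rw [← mul_assoc, mul_comm _ (Per m E K), div_eq_mul_inv]
          congr 1
          rw [show (4 : ℝ≥0∞) = 2 * 2 by norm_num, ENNReal.mul_inv (by simp) (by simp), mul_assoc,
            ENNReal.inv_mul_cancel (by simp) (by simp), mul_one]
    calc _ ≤ Per m E K / 2 + Per m E K / 2 := by gcongr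
      _ = Per m E K := ENNReal.add_halves _

end ZeroDensity

section EssentialBoundary

variable [MetricSpace X] [MeasurableSpace X] {m : Measure X} {C : NNReal} {lam : ℝ}

theorem PIBound.measure_compl_inter_div (h : PIBound m C lam) {E : Set X} (hE : MeasurableSet E)
    (x : X) {r : ℝ} (hr : 0 < r) :
    m (Eᶜ ∩ ball x r) / m (ball x r) = 1 - m (E ∩ ball x r) / m (ball x r) := by
  have h0 := h.ball_ne_zero x r hr
  have htop := h.ball_ne_top x r
  have h1 : m (E ∩ ball x r) / m (ball x r) + m (Eᶜ ∩ ball x r) / m (ball x r) = 1 := by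
    rw [← ENNReal.add_div, inter_comm E, inter_comm Eᶜ, ← Set.sdiff_eq, measure_inter_add_sdiff _ hE,
      ENNReal.div_self h0 htop]
  refine ENNReal.eq_sub_of_add_eq' (by simp) ?_
  rwa [add_comm]

theorem PIBound.essExt_compl (h : PIBound m C lam) {E : Set X} (hE : MeasurableSet E) :
    essExt m Eᶜ = essInt m E := by
  ext x
  constructor
  · intro hx
    have := ENNReal.Tendsto.sub (tendsto_const_nhds (x := (1 : ℝ≥0∞))) hx (.inl (by simp))
    rw [tsub_zero] at this
    refine this.congr' ?_
    filter_upwards [self_mem_nhdsWithin] with r hr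
    rw [← h.measure_compl_inter_div hE.compl x hr, compl_compl]
  · intro hx
    have := ENNReal.Tendsto.sub (tendsto_const_nhds (x := (1 : ℝ≥0∞))) hx (.inl (by simp))
    rw [tsub_self] at this
    refine this.congr' ?_
    filter_upwards [self_mem_nhdsWithin] with r hr
    rw [← h.measure_compl_inter_div hE x hr]

theorem HasLocFinPer.compl [BorelSpace X] {E : Set X} (h : HasLocFinPer m E) :
    HasLocFinPer m Eᶜ := fun x => by
  simpa only [Per_compl] using h x

theorem PIBound.measure_inter_ball_le_of_mem_closure (h : PIBound m C lam) {E A : Set X} {ρ : ℝ}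
    {δ : ℝ≥0∞} (hA : ∀ x ∈ A, ∀ r, 0 < r → r < ρ → m (E ∩ ball x r) ≤ δ * m (ball x r)) {x : X}
    (hx : x ∈ closure A) {r : ℝ} (hr0 : 0 < r) (hr : 2 * r < ρ) (hr1 : 3 * r < 2) :
    m (E ∩ ball x r) ≤ δ * C ^ 2 * m (ball x r) := by
  obtain ⟨y, hy, hxy⟩ := Metric.mem_closure_iff.1 hx r hr0
  calc m (E ∩ ball x r) ≤ m (E ∩ ball y (2 * r)) := by
        gcongr
        exact ball_subset_ball' (by linarith)
    _ ≤ δ * m (ball y (2 * r)) := hA y hy _ (by linarith) hr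
    _ ≤ δ * m (ball x (3 * r)) := by
      gcongr
      exact ball_subset_ball' (by rw [dist_comm]; linarith)
    _ ≤ δ * (C ^ 2 * m (ball x r)) := by
      gcongr
      exact h.doubling x 2 _ _ hr1 (by linarith)
    _ = _ := by ring

/-- Sets that are locally null for the perimeter are null. -/
theorem Per_eq_zero_of_locally [BorelSpace X] [ProperSpace X] {E A : Set X} (hE : MeasurableSet E)
    (hEp : HasLocFinPer m E)
    (h : ∀ x ρ, Per m E (ball x ρ) < ∞ → Per m E (A ∩ ball x (ρ / 2)) = 0) : Per m E A = 0 := by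
  refine measure_null_of_locally_null (μ := perOuter m hE) A fun x _ => ?_
  obtain ⟨ρ, hρ, hfin⟩ := hEp x
  exact ⟨A ∩ ball x (ρ / 2), inter_mem_nhdsWithin _ (ball_mem_nhds x (half_pos hρ)), h x ρ hfin⟩

theorem PIBound.Per_essExt [BorelSpace X] [ProperSpace X] (h : PIBound m C lam) {E : Set X}
    (hE : MeasurableSet E) (hEp : HasLocFinPer m E) : Per m E (essExt m E) = 0 := by
  obtain ⟨δ, hδ0, hδ⟩ := h.exists_density_threshold
  have hC0 : 0 < C := one_pos.trans_le h.one_le_const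
  set δ' : NNReal := δ / C ^ 2 with hδ'
  have hδ'0 : 0 < δ' := by positivity
  set A : ℕ → Set X := fun j =>
    {x | ∀ r, 0 < r → r < 1 / ((j : ℝ) + 1) → m (E ∩ ball x r) ≤ δ' * m (ball x r)} with hA
  have hcov : essExt m E ⊆ ⋃ j, A j := by
    intro x hx
    have hx' : Tendsto (fun r : ℝ => m (E ∩ ball x r) / m (ball x r)) (𝓝[>] 0) (𝓝 0) := hx
    obtain ⟨ε, hε, hsub⟩ := mem_nhdsGT_iff_exists_Ioo_subset.1
      (hx'.eventually (ge_mem_nhds (show (0 : ℝ≥0∞) < δ' by exact_mod_cast hδ'0)))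
    obtain ⟨j, hj⟩ := exists_nat_one_div_lt (mem_Ioi.1 hε)
    refine mem_iUnion.2 ⟨j, fun r hr0 hr => ?_⟩
    have : m (E ∩ ball x r) / m (ball x r) ≤ δ' := hsub ⟨hr0, hr.trans hj⟩
    rwa [ENNReal.div_le_iff (h.ball_ne_zero x r hr0) (h.ball_ne_top x r)] at this
  refine le_antisymm ?_ zero_le
  refine (Per_mono E hcov).trans ((Per_iUnion_le hE A).trans (le_of_eq ?_))
  refine ENNReal.tsum_eq_zero.2 fun j => Per_eq_zero_of_locally hE hEp fun x ρ hfin => ?_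
  rcases le_or_gt ρ 0 with hρ | hρ
  · rw [ball_eq_empty.2 (by linarith), inter_empty, Per_empty]
  refine le_antisymm ?_ zero_le
  have hsub : A j ∩ ball x (ρ / 2) ⊆ closure (A j) ∩ closedBall x (ρ / 2) :=
    inter_subset_inter subset_closure ball_subset_closedBall
  refine (Per_mono E hsub).trans (le_of_eq ?_)
  refine hδ E _ hE ((isCompact_closedBall x _).inter_left isClosed_closure)
    (ne_top_of_le_ne_top hfin.ne (Per_mono E (inter_subset_right.trans
      (closedBall_subset_ball (by linarith))))) ?_
  refine ⟨min (1 / ((j : ℝ) + 1) / 2) (1 / 2), by positivity, fun y hy r hr0 hr => ?_⟩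
  have h1 := hr.trans_le (min_le_left _ _)
  have h2 := hr.trans_le (min_le_right _ _)
  have := h.measure_inter_ball_le_of_mem_closure (E := E) (fun z hz => hz) hy.1 hr0
    (show 2 * r < 1 / ((j : ℝ) + 1) by linarith) (by linarith)
  refine this.trans (le_of_eq ?_)
  congr 1
  have : δ' * C ^ 2 = δ := by rw [hδ']; field_simp
  exact_mod_cast this

theorem PIBound.Per_essInt [BorelSpace X] [ProperSpace X] (h : PIBound m C lam) {E : Set X}
    (hE : MeasurableSet E) (hEp : HasLocFinPer m E) : Per m E (essInt m E) = 0 := by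
  rw [← h.essExt_compl hE, ← Per_compl]
  exact h.Per_essExt hE.compl hEp.compl

theorem PIBound.mem_essExt_of_frequently (h : PIBound m C lam)
    {E : Set X} (hE : MeasurableSet E) {x : X}
    (hmin : ∀ k : ℕ, ∀ᶠ r in 𝓝[>] (0 : ℝ),
      k * min (m (E ∩ ball x r)) (m (Eᶜ ∩ ball x r)) < m (ball x r))
    (hlow : ∃ᶠ r in 𝓝[>] (0 : ℝ), m (E ∩ ball x r) ≤ m (Eᶜ ∩ ball x r)) : x ∈ essExt m E := by
  have hadd : ∀ r, m (E ∩ ball x r) + m (Eᶜ ∩ ball x r) = m (ball x r) := fun r => by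
    rw [inter_comm E, inter_comm Eᶜ, ← Set.sdiff_eq, measure_inter_add_sdiff _ hE]
  obtain ⟨K, hK⟩ := exists_nat_ge (C + 1)
  have hKC : (C : ℝ≥0∞) + 1 ≤ K := by exact_mod_cast hK
  have hK2 : (2 : ℝ≥0∞) ≤ K := by
    refine le_trans ?_ hKC
    rw [← one_add_one_eq_two]
    gcongr
    exact_mod_cast h.one_le_const
  obtain ⟨r₀, hr₀, hsub⟩ := mem_nhdsGT_iff_exists_Ioo_subset.1 (hmin K)
  obtain ⟨r, hr, hrlow⟩ := ((hlow.and_eventually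
    (Ioo_mem_nhdsGT (lt_min (mem_Ioi.1 hr₀) one_pos))).exists).imp fun _ hr => hr.symm
  have hdich : ∀ t, 0 < t → t ≤ r →
      K * m (E ∩ ball x t) < m (ball x t) ∨ K * m (Eᶜ ∩ ball x t) < m (ball x t) := by
    intro t ht htr
    have : K * min (m (E ∩ ball x t)) (m (Eᶜ ∩ ball x t)) < m (ball x t) :=
      hsub ⟨ht, htr.trans_lt (hr.2.trans_le (min_le_left _ _))⟩
    rcases le_total (m (E ∩ ball x t)) (m (Eᶜ ∩ ball x t)) with h' | h'
    · exact .inl (by rwa [min_eq_left h'] at this)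
    · exact .inr (by rwa [min_eq_right h'] at this)
  have hr1 : r < 1 := hr.2.trans_le (min_le_right _ _)
  have hhalf : ∀ s t, 0 < t → t ≤ s → s ≤ r → s ≤ 2 * t → K * m (E ∩ ball x s) < m (ball x s) →
      K * m (E ∩ ball x t) < m (ball x t) := by
    intro s t ht hts hsr hst hs
    refine (hdich t ht (hts.trans hsr)).resolve_right fun hbad => ?_
    have h1 : K * m (E ∩ ball x t) ≤ C * m (ball x t) := by
      calc K * m (E ∩ ball x t) ≤ K * m (E ∩ ball x s) := by gcongr
        _ ≤ m (ball x s) := hs.le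
        _ ≤ C ^ 1 * m (ball x t) := h.doubling x 1 _ _ (by linarith) (by linarith)
        _ = C * m (ball x t) := by rw [pow_one]
    have h2 : K * m (ball x t) < (C + 1) * m (ball x t) := by
      calc K * m (ball x t) = K * m (E ∩ ball x t) + K * m (Eᶜ ∩ ball x t) := by
            rw [← hadd t, mul_add]
        _ < C * m (ball x t) + m (ball x t) :=
          ENNReal.add_lt_add_of_le_of_lt
            (h1.trans_lt (ENNReal.mul_lt_top (by simp) (h.ball_ne_top x t).lt_top)).ne h1 hbad
        _ = _ := by ring
    exact h2.not_ge (by gcongr)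
  have hr' : K * m (E ∩ ball x r) < m (ball x r) := by
    have : K * min (m (E ∩ ball x r)) (m (Eᶜ ∩ ball x r)) < m (ball x r) :=
      hsub ⟨hr.1, hr.2.trans_le (min_le_left _ _)⟩
    rwa [min_eq_left hrlow] at this
  have hind : ∀ n : ℕ, ∀ t, 0 < t → t ≤ r → r ≤ 2 ^ n * t →
      K * m (E ∩ ball x t) < m (ball x t) := by
    intro n
    induction n with
    | zero =>
      intro t _ htr hrt
      obtain rfl : t = r := le_antisymm htr (by linarith)
      exact hr'
    | succ n ih =>
      intro t ht htr hrt
      have hpow : (1 : ℝ) ≤ 2 ^ n := one_le_pow₀ one_le_two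
      refine hhalf (min (2 * t) r) t ht (le_min (by linarith) htr) (min_le_right _ _)
        (min_le_left _ _) (ih _ (lt_min (by linarith) hr.1) (min_le_right _ _) ?_)
      rcases le_total (2 * t) r with h' | h'
      · rw [min_eq_left h']
        rw [pow_succ] at hrt
        linarith
      · rw [min_eq_right h']
        exact le_mul_of_one_le_left hr.1.le hpow
  have hall : ∀ t, 0 < t → t ≤ r → m (E ∩ ball x t) ≤ m (Eᶜ ∩ ball x t) := by
    intro t ht htr
    obtain ⟨n, hn⟩ := pow_unbounded_of_one_lt (r / t) (one_lt_two : (1 : ℝ) < 2)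
    have h1 := hind n t ht htr (by rw [div_lt_iff₀ ht] at hn; exact hn.le)
    by_contra! hlt
    refine h1.not_ge ?_
    calc m (ball x t) = m (E ∩ ball x t) + m (Eᶜ ∩ ball x t) := (hadd t).symm
      _ ≤ m (E ∩ ball x t) + m (E ∩ ball x t) := by gcongr
      _ = 2 * m (E ∩ ball x t) := (two_mul _).symm
      _ ≤ _ := by gcongr
  refine ENNReal.tendsto_nhds_zero.2 fun ε hε => ?_
  obtain ⟨k, hk⟩ := ENNReal.exists_inv_nat_lt hε.ne'
  filter_upwards [hmin k, Ioo_mem_nhdsGT hr.1] with t ht htr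
  rw [min_eq_left (hall t htr.1 htr.2.le)] at ht
  refine le_trans ?_ hk.le
  refine ENNReal.div_le_of_le_mul ?_
  rw [← ENNReal.div_eq_inv_mul]
  refine ENNReal.le_div_iff_mul_le (.inr ?_) (.inl (by simp)) |>.2 (by rw [mul_comm]; exact ht.le)
  exact h.ball_ne_zero x t htr.1

theorem PIBound.exists_frequently_of_mem_essBdry (h : PIBound m C lam)
    {E : Set X} (hE : MeasurableSet E) {x : X} (hx : x ∈ essBdry m E) :
    ∃ k : ℕ, ∃ᶠ r in 𝓝[>] (0 : ℝ),
      m (ball x r) ≤ k * min (m (E ∩ ball x r)) (m (Eᶜ ∩ ball x r)) := by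
  by_contra! H
  refine hx ?_
  by_cases hlow : ∃ᶠ r in 𝓝[>] (0 : ℝ), m (E ∩ ball x r) ≤ m (Eᶜ ∩ ball x r)
  · exact .inr (h.mem_essExt_of_frequently hE H hlow)
  · rw [not_frequently] at hlow
    rw [← h.essExt_compl hE]
    refine .inl (h.mem_essExt_of_frequently hE.compl (fun k => ?_) ?_)
    · simpa only [compl_compl, min_comm] using H k
    · refine (hlow.mono fun r hr => ?_).frequently
      rw [compl_compl]
      exact (not_le.1 hr).le

end EssentialBoundary

section CommonBoundary

variable [MetricSpace X] [MeasurableSpace X] {m : Measure X} {C : NNReal} {lam : ℝ}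

theorem exists_cutoff_finset [OpensMeasurableSpace X] (m : Measure X) (S : Finset X) {R : X → ℝ}
    (hR : ∀ y ∈ S, 0 < R y) :
    ∃ (φ : X → ℝ) (K : NNReal), LipschitzWith K φ ∧ (∀ x, 0 ≤ φ x ∧ φ x ≤ 1) ∧
      (∀ x ∈ ⋃ y ∈ S, ball y (R y), φ x = 0) ∧
      (∀ x ∉ ⋃ y ∈ S, closedBall y (2 * R y), φ x = 1) ∧
      ∫⁻ x, mSlope φ x ∂m ≤ ∑ y ∈ S, m (closedBall y (2 * R y)) / ENNReal.ofReal (R y) := by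
  set ψ : X → X → ℝ := fun y x => 1 - ramp (R y) (2 * R y) (dist x y) with hψ
  have hψ01 : ∀ y x, 0 ≤ ψ y x := fun y x => by
    have := (ramp_mem (R y) (2 * R y) (dist x y)).2
    simp only [hψ]
    linarith
  have hlip : ∀ y ∈ S, LipschitzWith (R y)⁻¹.toNNReal (ψ y) := fun y hy => by
    have := (LipschitzWith.dist_left y).ramp_comp (show R y < 2 * R y by linarith [hR y hy])
    rw [show 2 * R y - R y = R y by ring] at this
    refine LipschitzWith.of_dist_le_mul fun x z => ?_
    refine le_trans (le_of_eq ?_) (this.dist_le_mul x z)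
    simp only [hψ, dist_sub_left]
  set φ : X → ℝ := fun x => max 0 (1 - ∑ y ∈ S, ψ y x) with hφ
  have hφσ : ∀ x z, |φ x - φ z| ≤ |∑ y ∈ S, ψ y x - ∑ y ∈ S, ψ y z| := fun x z => by
    have := abs_max_sub_max_le_abs (1 - ∑ y ∈ S, ψ y x) (1 - ∑ y ∈ S, ψ y z) 0
    rw [show 1 - ∑ y ∈ S, ψ y x - (1 - ∑ y ∈ S, ψ y z) = ∑ y ∈ S, ψ y z - ∑ y ∈ S, ψ y x by ring,
      abs_sub_comm (∑ y ∈ S, ψ y z)] at this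
    simpa only [hφ, max_comm] using this
  have hout : ∀ y ∈ S, ∀ x ∉ closedBall y (2 * R y), ψ y x = 0 := fun y hy x hx => by
    simp only [hψ]
    rw [ramp_eq_one (by linarith [hR y hy]) (not_le.1 hx).le, sub_self]
  refine ⟨φ, ∑ y ∈ S, (R y)⁻¹.toNNReal, ?_, fun x => ⟨le_max_left _ _, ?_⟩, ?_, ?_, ?_⟩
  · refine LipschitzWith.of_dist_le_mul fun x z => ?_
    rw [Real.dist_eq]
    refine (hφσ x z).trans ?_
    rw [← Finset.sum_sub_distrib, NNReal.coe_sum, Finset.sum_mul]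
    refine (Finset.abs_sum_le_sum_abs _ _).trans (Finset.sum_le_sum fun y hy => ?_)
    exact (hlip y hy).dist_le_mul x z
  · refine max_le zero_le_one ?_
    linarith [Finset.sum_nonneg fun y (_ : y ∈ S) => hψ01 y x]
  · intro x hx
    obtain ⟨y, hy, hxy⟩ := mem_iUnion₂.1 hx
    refine max_eq_left ?_
    have h1 : ψ y x = 1 := by
      simp only [hψ]
      rw [ramp_eq_zero (by linarith [hR y hy]) (mem_ball.1 hxy).le, sub_zero]
    linarith [Finset.single_le_sum (fun z _ => hψ01 z x) hy]
  · intro x hx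
    have : ∑ y ∈ S, ψ y x = 0 := Finset.sum_eq_zero fun y hy =>
      hout y hy x fun hxy => hx (mem_biUnion hy hxy)
    simp [hφ, this]
  · have hslope : ∀ y ∈ S, ∀ x, mSlope (ψ y) x ≤
        (closedBall y (2 * R y)).indicator (fun _ => ENNReal.ofReal (R y)⁻¹) x := by
      intro y hy x
      by_cases hx : x ∈ closedBall y (2 * R y)
      · rw [indicator_of_mem hx]
        exact (hlip y hy).mSlope_le x
      · rw [indicator_of_notMem hx]
        refine (mSlope_eq_zero_of_eventuallyEq_const (c := 0) ?_).le
        filter_upwards [isClosed_closedBall.isOpen_compl.mem_nhds hx] with z hz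
        exact hout y hy z hz
    calc ∫⁻ x, mSlope φ x ∂m
        ≤ ∫⁻ x, ∑ y ∈ S,
          (closedBall y (2 * R y)).indicator (fun _ => ENNReal.ofReal (R y)⁻¹) x ∂m := by
          refine lintegral_mono fun x => ?_
          refine (mSlope_mono (g := fun x => ∑ y ∈ S, ψ y x)
            (Eventually.of_forall (hφσ x))).trans ?_
          exact (mSlope_sum_le S ψ x).trans (Finset.sum_le_sum fun y hy => hslope y hy x)
      _ = ∑ y ∈ S, m (closedBall y (2 * R y)) / ENNReal.ofReal (R y) := by
        rw [lintegral_finsetSum _ fun y _ => measurable_const.indicator measurableSet_closedBall]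
        refine Finset.sum_congr rfl fun y hy => ?_
        rw [lintegral_indicator_const measurableSet_closedBall,
          ENNReal.ofReal_inv_of_pos (hR y hy), mul_comm, div_eq_mul_inv, mul_comm]
      _ ≤ _ := le_rfl

variable [BorelSpace X] [ProperSpace X]

theorem PIBound.exists_cutoff (h : PIBound m C lam) {E F A Ω : Set X} (hE : MeasurableSet E)
    (hF : MeasurableSet F) (hΩ : IsOpen Ω) (hAΩ : A ⊆ Ω) (hPA : Per m E A = 0) {k : ℕ}
    (hk : ∀ x ∈ A, ∃ᶠ r in 𝓝[>] (0 : ℝ),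
      m (ball x r) ≤ k * min (m (E ∩ ball x r)) (m (Eᶜ ∩ ball x r)))
    {c ε : ℝ≥0∞} (hc : c < Per m F A) (hε : ε ≠ 0) {s₀ : ℝ} (hs₀ : 0 < s₀) :
    ∃ (V Q : Set X) (φ : X → ℝ) (K : NNReal), IsOpen V ∧ V ⊆ Ω ∧ IsCompact Q ∧ Q ⊆ Ω ∧
      LipschitzWith K φ ∧ (∀ x, 0 ≤ φ x ∧ φ x ≤ 1) ∧ (∀ x ∈ V, φ x = 0) ∧ (∀ x ∉ Q, φ x = 1) ∧
      m Q ≤ ENNReal.ofReal s₀ * ε ∧ ∫⁻ x, mSlope φ x ∂m ≤ ε ∧ c < Per m F V := by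
  classical
  have hlam := h.one_le_lam
  have hne : A.Nonempty := by
    rw [nonempty_iff_ne_empty]
    rintro rfl
    rw [Per_empty] at hc
    exact not_lt_bot hc
  obtain ⟨l, hl⟩ := pow_unbounded_of_one_lt (23 * lam) (one_lt_two : (1 : ℝ) < 2)
  have hη : Per m E A < ε / (C ^ l * (k * C)) := by
    rw [hPA]
    refine ENNReal.div_pos hε ?_
    exact_mod_cast ENNReal.coe_ne_top (r := C ^ l * (k * C))
  obtain ⟨U₀, hU₀, hAU₀, hPU₀⟩ := exists_isOpen_Per_lt hη
  set U := U₀ ∩ Ω with hUdef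
  have hU : IsOpen U := hU₀.inter hΩ
  have hAU : A ⊆ U := subset_inter hAU₀ hAΩ
  have hPU : C ^ l * (k * C) * Per m E U ≤ ε := by
    rw [mul_comm]
    exact (ENNReal.mul_lt_of_lt_div ((Per_mono E inter_subset_left).trans_lt hPU₀)).le
  have hscale : ∀ x ∈ A, ∃ s, 0 < s ∧ s ≤ s₀ ∧ 23 * lam * s < 2 ∧ closedBall x (22 * lam * s) ⊆ U ∧
      m (ball x s) ≤ k * C * ENNReal.ofReal s * Per m E (ball x (2 * lam * s)) := by
    intro x hx
    obtain ⟨ρ, hρ, hρU⟩ := Metric.nhds_basis_closedBall.mem_iff.1 (hU.mem_nhds (hAU hx))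
    have hpos : 0 < min s₀ (min (1 / (23 * lam)) (ρ / (22 * lam))) := by positivity
    obtain ⟨s, hs, hs'⟩ := ((hk x hx).and_eventually (Ioo_mem_nhdsGT hpos)).exists
    have h1 := hs'.2.trans_le (min_le_left _ _)
    have h2 := (hs'.2.trans_le (min_le_right _ _)).trans_le (min_le_left _ _)
    have h3 := (hs'.2.trans_le (min_le_right _ _)).trans_le (min_le_right _ _)
    rw [lt_div_iff₀ (by positivity)] at h2 h3
    refine ⟨s, hs'.1, h1.le, by linarith, ?_, ?_⟩
    · exact (closedBall_subset_closedBall (by linarith)).trans hρU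
    · have hs1 : s < 1 := by nlinarith [hs'.1]
      refine hs.trans ?_
      rw [mul_assoc (k : ℝ≥0∞), mul_assoc (k : ℝ≥0∞)]
      gcongr
      have := h.isoperimetric E hE x s hs'.1 hs1
      rwa [Set.sdiff_eq, inter_comm (ball x s) Eᶜ] at this
  choose! s hs0 hss hs2 hsU hs using hscale
  obtain ⟨u, huA, hu, hcov, hsum⟩ := exists_vitali_cover (D := k * C) hU hlam
    (fun y hy => ⟨hs0 y hy, hss y hy⟩)
    (fun y hy => (ball_subset_closedBall.trans (closedBall_subset_closedBall (by
      nlinarith [hs0 y hy, mul_pos (show 0 < lam by linarith) (hs0 y hy)]))).trans (hsU y hy)) hs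
  have hune : u.Nonempty := by
    obtain ⟨x, hx⟩ := hne
    obtain ⟨y, hy, -⟩ := mem_iUnion₂.1 (hcov hx)
    exact ⟨y, hy⟩
  obtain ⟨f, hf⟩ := hu.exists_eq_range hune
  have hfA : ∀ i, f i ∈ A := fun i => huA (hf ▸ mem_range_self i)
  set W : ℕ → Set X := accumulate fun i => ball (f i) (11 * lam * s (f i)) with hW
  have hWo : ∀ n, IsOpen (W n) := fun n => isOpen_biUnion fun _ _ => isOpen_ball
  have hAW : A ⊆ ⋃ n, W n := by
    rw [iUnion_accumulate]
    rwa [hf, biUnion_range] at hcov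
  have hsup := Per_iUnion_eq_iSup (m := m) hF (monotone_accumulate (s := fun i =>
    ball (f i) (11 * lam * s (f i)))) fun n => (hWo n).measurableSet
  obtain ⟨n, hn⟩ := lt_iSup_iff.1 (hsup ▸ hc.trans_le (Per_mono F hAW))
  set S : Finset X := (Finset.range (n + 1)).image f with hS
  have hSu : (S : Set X) ⊆ u := by
    intro y hy
    obtain ⟨i, -, rfl⟩ := Finset.mem_image.1 hy
    exact hf ▸ mem_range_self i
  have hSA : ∀ y ∈ S, y ∈ A := fun y hy => huA (hSu hy)
  have hVW : ⋃ y ∈ S, ball y (11 * lam * s y) = W n := by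
    ext x
    simp [hS, hW, mem_accumulate]
  have hR : ∀ y ∈ S, 0 < 11 * lam * s y := fun y hy => by
    have := hs0 y (hSA y hy)
    positivity
  have hsumS : ∑ y ∈ S, m (ball y (s y)) / ENNReal.ofReal (s y) ≤ k * C * Per m E U := by
    refine le_trans ?_ hsum
    rw [← Finset.tsum_subtype S fun y => m (ball y (s y)) / ENNReal.ofReal (s y)]
    exact ENNReal.tsum_mono_subtype (fun y => m (ball y (s y)) / ENNReal.ofReal (s y)) hSu
  have hball : ∀ y ∈ S, m (closedBall y (2 * (11 * lam * s y))) ≤ C ^ l * m (ball y (s y)) := by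
    intro y hy
    have hy0 := hs0 y (hSA y hy)
    have := mul_pos (show 0 < lam by linarith) hy0
    refine (measure_mono (closedBall_subset_ball (show 2 * (11 * lam * s y) < 23 * lam * s y by
      linarith))).trans ?_
    exact h.doubling y l _ _ (hs2 y (hSA y hy)) (mul_le_mul_of_nonneg_right hl.le hy0.le)
  have hQU : ⋃ y ∈ S, closedBall y (2 * (11 * lam * s y)) ⊆ U :=
    iUnion₂_subset fun y hy => by
      rw [show 2 * (11 * lam * s y) = 22 * lam * s y by ring]
      exact hsU y (hSA y hy)
  obtain ⟨φ, K, hφ, hφ01, hφV, hφQ, hen⟩ := exists_cutoff_finset m S hR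
  have hVQ : ⋃ y ∈ S, ball y (11 * lam * s y) ⊆ ⋃ y ∈ S, closedBall y (2 * (11 * lam * s y)) :=
    iUnion₂_mono fun y hy => ball_subset_closedBall.trans
      (closedBall_subset_closedBall (by linarith [hR y hy]))
  refine ⟨⋃ y ∈ S, ball y (11 * lam * s y), ⋃ y ∈ S, closedBall y (2 * (11 * lam * s y)), φ, K,
    isOpen_biUnion fun _ _ => isOpen_ball,
    (hVQ.trans hQU).trans inter_subset_right,
    S.isCompact_biUnion fun y _ => isCompact_closedBall y _, hQU.trans inter_subset_right,
    hφ, hφ01, hφV, hφQ, ?_, ?_, ?_⟩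
  · calc m (⋃ y ∈ S, closedBall y (2 * (11 * lam * s y)))
        ≤ ∑ y ∈ S, m (closedBall y (2 * (11 * lam * s y))) := measure_biUnion_finset_le _ _
      _ ≤ ∑ y ∈ S, C ^ l * ENNReal.ofReal s₀ * (m (ball y (s y)) / ENNReal.ofReal (s y)) := by
        refine Finset.sum_le_sum fun y hy => (hball y hy).trans ?_
        have hy0 := hs0 y (hSA y hy)
        rw [mul_assoc]
        gcongr
        calc m (ball y (s y)) = ENNReal.ofReal (s y) * (m (ball y (s y)) / ENNReal.ofReal (s y)) :=
              (ENNReal.mul_div_cancel (by simpa using hy0) (by simp)).symm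
          _ ≤ _ := by
            gcongr
            exact hss y (hSA y hy)
      _ ≤ C ^ l * ENNReal.ofReal s₀ * (k * C * Per m E U) := by
        rw [← Finset.mul_sum]
        gcongr
      _ = ENNReal.ofReal s₀ * (C ^ l * (k * C) * Per m E U) := by ring
      _ ≤ _ := by gcongr
  · calc ∫⁻ x, mSlope φ x ∂m
        ≤ ∑ y ∈ S, m (closedBall y (2 * (11 * lam * s y))) / ENNReal.ofReal (11 * lam * s y) := hen
      _ ≤ ∑ y ∈ S, C ^ l * (m (ball y (s y)) / ENNReal.ofReal (s y)) := by
        refine Finset.sum_le_sum fun y hy => ?_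
        have hy0 := hs0 y (hSA y hy)
        rw [← mul_div_assoc]
        refine ENNReal.div_le_div (hball y hy) (ENNReal.ofReal_le_ofReal ?_)
        exact le_mul_of_one_le_left hy0.le (by linarith)
      _ ≤ C ^ l * (k * C * Per m E U) := by
        rw [← Finset.mul_sum]
        gcongr
      _ ≤ ε := by rwa [← mul_assoc]
  · rwa [hVW]

theorem PIBound.Per_eq_zero_of_Per_eq_zero (h : PIBound m C lam) {E F A Ω : Set X}
    (hE : MeasurableSet E) (hF : MeasurableSet F) (hΩ : IsOpen Ω) (hAΩ : A ⊆ Ω)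
    (hfin : Per m F Ω ≠ ∞) (hPA : Per m E A = 0) {k : ℕ}
    (hk : ∀ x ∈ A, ∃ᶠ r in 𝓝[>] (0 : ℝ),
      m (ball x r) ≤ k * min (m (E ∩ ball x r)) (m (Eᶜ ∩ ball x r))) : Per m F A = 0 := by
  have := h.isLocallyFiniteMeasure
  by_contra hP
  have hPtop : Per m F A ≠ ∞ := ne_top_of_le_ne_top hfin (Per_mono F hAΩ)
  obtain ⟨ε, hε⟩ : ∃ ε, ε = Per m F A / 4 := ⟨_, rfl⟩
  have hε0 : ε ≠ 0 := by simp [hε, hP]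
  have hεtop : ε ≠ ∞ := by rw [hε]; exact (ENNReal.div_lt_top hPtop (by simp)).ne
  have hεP : ε + ε < Per m F A := by
    have h4 : Per m F A = ε + ε + (ε + ε) := by
      have : ε + ε + (ε + ε) = 4 * ε := by ring
      rw [this, hε, ENNReal.mul_div_cancel (by simp) (by simp)]
    rw [h4]
    exact ENNReal.lt_add_right (by simp [hεtop]) (by simp [hε0])
  choose V Q φ K hV hVΩ hQ hQΩ hφ hφ01 hφV hφQ hmQ hen hPV using fun n : ℕ =>
    h.exists_cutoff hE hF hΩ hAΩ hPA hk hεP hε0 (Nat.one_div_pos_of_nat (α := ℝ) (n := n))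
  refine not_forall_cutoff_energy_lt hF hΩ hfin hV hVΩ hQ hQΩ hφ hφ01 hφV hφQ ?_ hε0 fun n => ?_
  · refine tendsto_of_tendsto_of_tendsto_of_le_of_le tendsto_const_nhds ?_ (fun _ => zero_le)
      fun n => (measure_mono inter_subset_right).trans (hmQ n)
    have h1 := ENNReal.tendsto_ofReal (tendsto_one_div_add_atTop_nhds_zero_nat (𝕜 := ℝ))
    simpa using ENNReal.Tendsto.mul_const h1 (.inr hεtop)
  · refine le_trans ?_ (hPV n).le
    gcongr
    exact (lintegral_mono' Measure.restrict_le_self le_rfl).trans (hen n)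

theorem PIBound.Per_essBdry_inter_essBdry (h : PIBound m C lam) {E F : Set X}
    (hE : MeasurableSet E) (hF : MeasurableSet F) (hFp : HasLocFinPer m F)
    (hP : Per m E (essBdry m F) = 0) : Per m F (essBdry m E ∩ essBdry m F) = 0 := by
  set A : ℕ → Set X := fun k => {x | x ∈ essBdry m F ∧ ∃ᶠ r in 𝓝[>] (0 : ℝ),
    m (ball x r) ≤ k * min (m (E ∩ ball x r)) (m (Eᶜ ∩ ball x r))}
  have hcov : essBdry m E ∩ essBdry m F ⊆ ⋃ k, A k := fun x hx => by
    obtain ⟨k, hk⟩ := h.exists_frequently_of_mem_essBdry hE hx.1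
    exact mem_iUnion.2 ⟨k, hx.2, hk⟩
  refine le_antisymm ?_ zero_le
  refine (Per_mono F hcov).trans ((Per_iUnion_le hF A).trans (le_of_eq ?_))
  refine ENNReal.tsum_eq_zero.2 fun k => Per_eq_zero_of_locally hF hFp fun x ρ hfin => ?_
  rcases le_or_gt ρ 0 with hρ | hρ
  · rw [ball_eq_empty.2 (by linarith), inter_empty, Per_empty]
  refine h.Per_eq_zero_of_Per_eq_zero hE hF (isOpen_ball (x := x) (ε := ρ))
    (inter_subset_right.trans (ball_subset_ball (by linarith))) hfin.ne ?_ fun y hy => hy.1.2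
  refine le_antisymm ?_ zero_le
  rw [← hP]
  exact Per_mono E fun y hy => hy.1.1

end CommonBoundary

section Intersection

variable [MetricSpace X] [MeasurableSpace X] {m : Measure X}

theorem essExt_anti {E F : Set X} (h : E ⊆ F) : essExt m F ⊆ essExt m E := fun _ hx =>
  tendsto_of_tendsto_of_tendsto_of_le_of_le tendsto_const_nhds hx (fun _ => zero_le) fun _ =>
    ENNReal.div_le_div_right (measure_mono (inter_subset_inter_left _ h)) _

variable [BorelSpace X]

theorem Per_zero_measure (E A : Set X) : Per (0 : Measure X) E A = 0 := by
  refine le_antisymm ?_ zero_le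
  refine Per_le_of_forall_le (f := fun _ _ => 0) (e := fun _ => 0) isOpen_univ (subset_univ A)
    (fun _ x _ => lipNear_const 0 x) ?_ tendsto_const_nhds (by simp)
  intro K _ _
  simp

theorem HasLocFinPer.inter {E F : Set X} (hEm : MeasurableSet E) (hE : HasLocFinPer m E)
    (hF : HasLocFinPer m F) : HasLocFinPer m (E ∩ F) := fun x => by
  obtain ⟨r, hr, hEr⟩ := hE x
  obtain ⟨s, hs, hFs⟩ := hF x
  refine ⟨min r s, lt_min hr hs, (Per_inter_le hEm F _).trans_lt (ENNReal.add_lt_top.2 ⟨?_, ?_⟩)⟩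
  · exact (Per_mono E (ball_subset_ball (min_le_left r s))).trans_lt hEr
  · exact (Per_mono F (ball_subset_ball (min_le_right r s))).trans_lt hFs

theorem PIBound.Per_inter_le_add [ProperSpace X] {C : NNReal} {lam : ℝ} (h : PIBound m C lam)
    {E F : Set X} (hE : MeasurableSet E) (hF : MeasurableSet F) (hEp : HasLocFinPer m E)
    (hFp : HasLocFinPer m F) (hP : Per m E (essBdry m F) = 0) (B : Set X) :
    Per m (E ∩ F) B ≤ Per m E (B ∩ essInt m F) + Per m F (B ∩ essInt m E) := by
  have hEF := hE.inter hF
  have h1 : Per m (E ∩ F) (B ∩ essInt m F) ≤ Per m E (B ∩ essInt m F) := by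
    refine (Per_inter_le hE F _).trans ?_
    rw [le_antisymm ((Per_mono F inter_subset_right).trans (h.Per_essInt hF hFp).le) zero_le,
      add_zero]
  have h2 : Per m (E ∩ F) (B ∩ essInt m E) ≤ Per m F (B ∩ essInt m E) := by
    refine (Per_inter_le hE F _).trans ?_
    rw [le_antisymm ((Per_mono E inter_subset_right).trans (h.Per_essInt hE hEp).le) zero_le,
      zero_add]
  have h3 : Per m (E ∩ F) (essExt m (E ∩ F)) = 0 :=
    h.Per_essExt hEF (hEp.inter hE hFp)
  have h4 : Per m (E ∩ F) (essBdry m E ∩ essBdry m F) = 0 := by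
    refine le_antisymm ((Per_inter_le hE F _).trans ?_) zero_le
    rw [h.Per_essBdry_inter_essBdry hE hF hFp hP, add_zero, ← hP]
    exact Per_mono E inter_subset_right
  have hcov : B ⊆ (B ∩ essInt m F ∪ B ∩ essInt m E) ∪
      (essExt m (E ∩ F) ∪ essBdry m E ∩ essBdry m F) := by
    intro x hx
    by_cases hxF : x ∈ essInt m F
    · exact .inl (.inl ⟨hx, hxF⟩)
    by_cases hxE : x ∈ essInt m E
    · exact .inl (.inr ⟨hx, hxE⟩)
    by_cases hxE0 : x ∈ essExt m E
    · exact .inr (.inl (essExt_anti inter_subset_left hxE0))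
    by_cases hxF0 : x ∈ essExt m F
    · exact .inr (.inl (essExt_anti inter_subset_right hxF0))
    · exact .inr (.inr ⟨fun h => h.elim hxE hxE0, fun h => h.elim hxF hxF0⟩)
  calc Per m (E ∩ F) B ≤ _ := Per_mono _ hcov
    _ ≤ _ := Per_union_le hEF _ _
    _ ≤ _ := add_le_add (Per_union_le hEF _ _) (Per_union_le hEF _ _)
    _ = Per m (E ∩ F) (B ∩ essInt m F) + Per m (E ∩ F) (B ∩ essInt m E) := by
      rw [h3, h4, add_zero, add_zero]
    _ ≤ _ := add_le_add h1 h2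

end Intersection

/-- **Perimeter of the intersection** (Proposition 2.4): if `E, F` have locally finite
perimeter in a PI space and `P(E, ∂^e F) = 0`, then
`P(E ∩ F, B) ≤ P(E, B ∩ F^{(1)}) + P(F, B ∩ E^{(1)})` for every Borel `B`. -/
theorem perimeter_of_intersection
    {X : Type*} [MetricSpace X] [CompleteSpace X] [TopologicalSpace.SeparableSpace X]
    [MeasurableSpace X] [BorelSpace X] (m : Measure X)
    (hbf : BoundedlyFinite m) (hPI : IsPIspace m)
    (E F : Set X) (hEm : MeasurableSet E) (hFm : MeasurableSet F)
    (hEp : HasLocFinPer m E) (hFp : HasLocFinPer m F)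
    (hPEF : Per m E (essBdry m F) = 0)
    (B : Set X) (hB : MeasurableSet B) :
    Per m (E ∩ F) B ≤ Per m E (B ∩ essInt m F) + Per m F (B ∩ essInt m E) := by
  rcases eq_or_ne m 0 with rfl | hm
  · simp [Per_zero_measure]
  have := hPI.properSpace hbf hm
  obtain ⟨C, lam, h⟩ := hPI.exists_bound hbf hm
  exact h.Per_inter_le_add hEm hFm hEp hFp hPEF B

end
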